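/- arXiv:2201.04776 — 2 statements merged into one kernel-verified Lean document; each statement's English description precedes it below -/
import Mathlib

section
/- For every positive integer m, the topological closure of U is contained in B_2(m); furthermore, the closure of U is contained in B_2^{(∞)}(m) := ∩_{i≥0} B_2^{(i)}(m). -/
/-- A sequence of digits has a last nonzero digit. -/
def hasLastNonzero (c : ℕ → ℕ) : Prop := ∃ n, c n ≠ 0 ∧ ∀ i > n, c i = 0

/-- `c` (with `c i` the `(i+1)`-st digit) is a `q`-expansion of `x`
with respect to the digit set `Ω_m = {0,1,…,m}`. -/
def isExpansion (m : ℕ) (q : ℝ) (x : ℝ) (c : ℕ → ℕ) : Prop :=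
  (∀ i, c i ≤ m) ∧ x = ∑' i : ℕ, (c i : ℝ) / q ^ (i + 1)

/-- The set `U_q` of points of `I_q = [0, m/(q-1)]` with a unique `q`-expansion. -/
def Uq (m : ℕ) (q : ℝ) : Set ℝ :=
  {x | x ∈ Set.Icc 0 ((m : ℝ) / (q - 1)) ∧ ∃! c, isExpansion m q x c}

/-- The set `U'_q` of digit sequences that are unique `q`-expansions. -/
def Uq' (m : ℕ) (q : ℝ) : Set (ℕ → ℕ) :=
  {c | isExpansion m q (∑' i : ℕ, (c i : ℝ) / q ^ (i + 1)) c ∧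
       ∀ d, isExpansion m q (∑' i : ℕ, (c i : ℝ) / q ^ (i + 1)) d → d = c}

/-- `B_2(m)`: bases `q ∈ (1, m+1]` for which some `x ∈ I_q` has exactly two
different `q`-expansions. -/
def B2 (m : ℕ) : Set ℝ :=
  {q | q ∈ Set.Ioc 1 ((m : ℝ) + 1) ∧
    ∃ x ∈ Set.Icc (0 : ℝ) ((m : ℝ) / (q - 1)), ∃ a b : ℕ → ℕ,
      a ≠ b ∧ isExpansion m q x a ∧ isExpansion m q x b ∧
      ∀ c, isExpansion m q x c → c = a ∨ c = b}

/-- Strict lexicographic order on digit sequences. -/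
def lexLt (a b : ℕ → ℕ) : Prop := ∃ n, (∀ i < n, a i = b i) ∧ a n < b n

/-- Lexicographic order on digit sequences. -/
def lexLe (a b : ℕ → ℕ) : Prop := lexLt a b ∨ a = b

/-- `a` is the quasi-greedy `q`-expansion of `1`: the lexicographically largest
`q`-expansion of `1` without a last nonzero digit. -/
def isQuasiGreedy (m : ℕ) (q : ℝ) (a : ℕ → ℕ) : Prop :=
  isExpansion m q 1 a ∧ ¬ hasLastNonzero a ∧
  ∀ b, isExpansion m q 1 b → ¬ hasLastNonzero b → lexLe b a

/-- `A'_q = {(c_i) ∈ U'_q : c_1 < α_1(q)}`. -/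
def Aq' (m : ℕ) (q : ℝ) : Set (ℕ → ℕ) :=
  {c | c ∈ Uq' m q ∧ ∀ a, isQuasiGreedy m q a → c 0 < a 0}

/-- `f_{c,d}(t) = (m+1)/t + Σ_{i≥1} (c_i + d_i) t^{-(i+1)} - m/(t-1)`. -/
noncomputable def fcd (m : ℕ) (c d : ℕ → ℕ) (t : ℝ) : ℝ :=
  ((m : ℝ) + 1) / t + (∑' i : ℕ, ((c i : ℝ) + (d i : ℝ)) / t ^ (i + 2)) - (m : ℝ) / (t - 1)

/-- `x = q_f(m)`: the largest real root of `q³-(k+2)q²+q-(k+1)=0` if `m = 2k+1`,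
and of `q²-(k+1)q-k=0` if `m = 2k`. -/
def isQf (m : ℕ) (x : ℝ) : Prop :=
  (∃ k : ℕ, m = 2 * k + 1 ∧
    x ^ 3 - ((k : ℝ) + 2) * x ^ 2 + x - ((k : ℝ) + 1) = 0 ∧
    ∀ y : ℝ, y ^ 3 - ((k : ℝ) + 2) * y ^ 2 + y - ((k : ℝ) + 1) = 0 → y ≤ x) ∨
  (∃ k : ℕ, m = 2 * k ∧
    x ^ 2 - ((k : ℝ) + 1) * x - (k : ℝ) = 0 ∧
    ∀ y : ℝ, y ^ 2 - ((k : ℝ) + 1) * y - (k : ℝ) = 0 → y ≤ x)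

/-- A doubly infinite sequence: neither it nor its reflection has a last nonzero digit. -/
def doublyInfinite (m : ℕ) (c : ℕ → ℕ) : Prop :=
  ¬ hasLastNonzero c ∧ ¬ hasLastNonzero (fun i => m - c i)

/-- `V_q`: points of `I_q` with at most one doubly infinite `q`-expansion. -/
def Vq (m : ℕ) (q : ℝ) : Set ℝ :=
  {x | x ∈ Set.Icc 0 ((m : ℝ) / (q - 1)) ∧
    ∀ a b : ℕ → ℕ, isExpansion m q x a → isExpansion m q x b →
      doublyInfinite m a → doublyInfinite m b → a = b}

/-- `U = {q ∈ (1, m+1] : 1 ∈ U_q}`. -/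
def Uset (m : ℕ) : Set ℝ := {q | q ∈ Set.Ioc 1 ((m : ℝ) + 1) ∧ (1 : ℝ) ∈ Uq m q}

/-- `V = {q ∈ (1, m+1] : 1 ∈ V_q}`. -/
def Vset (m : ℕ) : Set ℝ := {q | q ∈ Set.Ioc 1 ((m : ℝ) + 1) ∧ (1 : ℝ) ∈ Vq m q}

/-- The generalized golden ratio `G(m)`. -/
noncomputable def Gratio (m : ℕ) : ℝ :=
  if m % 2 = 0 then ((m / 2 : ℕ) : ℝ) + 1
  else (((m / 2 : ℕ) : ℝ) + 1 +
    Real.sqrt (((m / 2 : ℕ) : ℝ) ^ 2 + 6 * ((m / 2 : ℕ) : ℝ) + 5)) / 2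

/-- The set of accumulation points of a set of reals. -/
def accPts (S : Set ℝ) : Set ℝ := {x | AccPt x (Filter.principal S)}

/-- Iterated accumulation-point sets `B_2^{(i)}(m)`. -/
def B2iter (m : ℕ) : ℕ → Set ℝ
  | 0 => B2 m
  | n + 1 => accPts (B2iter m n)

namespace UnivoqueBases

/-- The sequence obtained by deleting the first `n` digits. -/
def shift (n : ℕ) (c : ℕ → ℕ) : ℕ → ℕ := fun i => c (n + i)

/-- The reflection of a digit sequence. -/
def reflect (m : ℕ) (c : ℕ → ℕ) : ℕ → ℕ := fun i => m - c i

/-- The value of a digit sequence in base `q`. -/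
noncomputable def val (q : ℝ) (c : ℕ → ℕ) : ℝ := ∑' i : ℕ, (c i : ℝ) / q ^ (i + 1)

/-- The first `i` digits of `a`, then the digit `k`, then the sequence `e`. -/
def splice (a : ℕ → ℕ) (i k : ℕ) (e : ℕ → ℕ) : ℕ → ℕ := fun j =>
  if j < i then a j else if j = i then k else e (j - (i + 1))

/-- `c` is the only digit sequence with its value in base `q`. -/
def IsUnique (m : ℕ) (q : ℝ) (c : ℕ → ℕ) : Prop :=
  ∀ d : ℕ → ℕ, (∀ i, d i ≤ m) → val q d = val q c → d = c

/-- Strict lexicographic order witnessed within the first `k` digits. -/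
def PrefixLt (k : ℕ) (a b : ℕ → ℕ) : Prop := ∃ n < k, (∀ i < n, a i = b i) ∧ a n < b n

/-- The lexicographic conditions describing quasi-greedy expansions of `1` in the closure
of the univoque bases. -/
structure Admissible (m : ℕ) (γ : ℕ → ℕ) : Prop where
  le : ∀ i, γ i ≤ m
  shift_le : ∀ i, lexLe (shift i γ) γ
  reflect_lt : ∀ i, lexLt (reflect m (shift i γ)) γ

section Lex

theorem lexLt_or_lexLt {a b : ℕ → ℕ} (h : a ≠ b) : lexLt a b ∨ lexLt b a := by
  classical
  have hex : ∃ n, a n ≠ b n := Function.ne_iff.1 h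
  have hmin : ∀ i < Nat.find hex, a i = b i := fun i hi => by
    simpa using Nat.find_min hex hi
  rcases lt_or_gt_of_ne (Nat.find_spec hex) with h1 | h1
  · exact Or.inl ⟨_, hmin, h1⟩
  · exact Or.inr ⟨_, fun i hi => (hmin i hi).symm, h1⟩

theorem lexLt_asymm {a b : ℕ → ℕ} (h : lexLt a b) : ¬ lexLt b a := by
  rintro ⟨k, hk, hk'⟩
  obtain ⟨n, hn, hn'⟩ := h
  rcases lt_trichotomy n k with h1 | h1 | h1
  · have := hk n h1; omega
  · subst h1; omega
  · have := hn k h1; omega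

theorem lexLt_irrefl (a : ℕ → ℕ) : ¬ lexLt a a := fun h => lexLt_asymm h h

theorem lexLe_of_not_lexLt {a b : ℕ → ℕ} (h : ¬ lexLt b a) : lexLe a b := by
  by_cases hab : a = b
  · exact Or.inr hab
  · exact Or.inl ((lexLt_or_lexLt hab).resolve_right h)

theorem not_lexLt_of_lexLe {a b : ℕ → ℕ} (h : lexLe a b) : ¬ lexLt b a := by
  rcases h with h | rfl
  · exact lexLt_asymm h
  · exact lexLt_irrefl a

theorem PrefixLt.lexLt {k : ℕ} {a b : ℕ → ℕ} (h : PrefixLt k a b) : lexLt a b :=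
  let ⟨n, _, h1, h2⟩ := h
  ⟨n, h1, h2⟩

theorem PrefixLt.congr {k : ℕ} {a b a' b' : ℕ → ℕ} (h : PrefixLt k a b)
    (ha : ∀ i < k, a' i = a i) (hb : ∀ i < k, b' i = b i) : PrefixLt k a' b' := by
  obtain ⟨n, hn, h1, h2⟩ := h
  refine ⟨n, hn, fun i hi => ?_, ?_⟩
  · rw [ha i (hi.trans hn), hb i (hi.trans hn), h1 i hi]
  · rw [ha n hn, hb n hn]; exact h2

theorem prefixLt_or_agree {a b : ℕ → ℕ} (h : lexLe a b) (k : ℕ) :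
    PrefixLt k a b ∨ ∀ i < k, a i = b i := by
  rcases h with ⟨n, h1, h2⟩ | rfl
  · rcases lt_or_ge n k with hn | hn
    · exact Or.inl ⟨n, hn, h1, h2⟩
    · exact Or.inr fun i hi => h1 i (hi.trans_le hn)
  · exact Or.inr fun _ _ => rfl

theorem shift_shift (i j : ℕ) (c : ℕ → ℕ) : shift i (shift j c) = shift (j + i) c := by
  funext k; simp [shift, add_assoc]

theorem shift_splice (a : ℕ → ℕ) (i k : ℕ) (e : ℕ → ℕ) :
    shift (i + 1) (splice a i k e) = e := by
  funext j
  simp only [shift, splice]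
  rw [if_neg (by omega), if_neg (by omega)]
  congr 1; omega

theorem splice_le {m i k : ℕ} {a e : ℕ → ℕ} (ha : ∀ j, a j ≤ m) (hk : k ≤ m)
    (he : ∀ j, e j ≤ m) (j : ℕ) : splice a i k e j ≤ m := by
  simp only [splice]
  split_ifs
  exacts [ha j, hk, he _]

end Lex

section Value

variable {m : ℕ} {q : ℝ}

theorem summable_val (hq : 1 < q) {c : ℕ → ℕ} (hc : ∀ i, c i ≤ m) :
    Summable fun i : ℕ => (c i : ℝ) / q ^ (i + 1) := by
  have hq0 : 0 < q := by linarith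
  have hg : Summable fun i : ℕ => (m : ℝ) * (1 / q) ^ i :=
    (summable_geometric_of_lt_one (by positivity) (by rw [div_lt_one hq0]; exact hq)).mul_left _
  refine Summable.of_nonneg_of_le (fun i => by positivity) (fun i => ?_) hg
  rw [one_div, inv_pow, ← div_eq_mul_inv]
  have : (c i : ℝ) ≤ m := by exact_mod_cast hc i
  exact div_le_div₀ (by positivity) this (by positivity)
    (pow_le_pow_right₀ hq.le (Nat.le_succ i))

theorem val_nonneg (hq : 1 < q) (c : ℕ → ℕ) : 0 ≤ val q c :=
  tsum_nonneg fun i => by positivity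

theorem val_const (hq : 1 < q) : val q (fun _ => m) = m / (q - 1) := by
  have hq0 : 0 < q := by linarith
  have hq1 : q - 1 ≠ 0 := by linarith
  have h := (hasSum_geometric_of_lt_one (r := 1 / q) (by positivity)
    (by rw [div_lt_one hq0]; exact hq)).mul_left ((m : ℝ) / q)
  have h2 : (fun i : ℕ => (m : ℝ) / q * (1 / q) ^ i) = fun i => (m : ℝ) / q ^ (i + 1) := by
    funext i
    rw [one_div, inv_pow, pow_succ]
    field_simp
  rw [h2] at h
  rw [val, h.tsum_eq]
  have : (1 : ℝ) - 1 / q ≠ 0 := by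
    rw [one_sub_div hq0.ne']
    exact div_ne_zero hq1 hq0.ne'
  field_simp

theorem val_le (hq : 1 < q) {c : ℕ → ℕ} (hc : ∀ i, c i ≤ m) : val q c ≤ m / (q - 1) := by
  rw [← val_const hq]
  refine (summable_val hq hc).tsum_le_tsum (fun i => ?_) (summable_val hq fun _ => le_rfl)
  have : (c i : ℝ) ≤ m := by exact_mod_cast hc i
  have hq0 : 0 < q := by linarith
  gcongr

theorem val_reflect (hq : 1 < q) {c : ℕ → ℕ} (hc : ∀ i, c i ≤ m) :
    val q (reflect m c) = m / (q - 1) - val q c := by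
  have hr : ∀ i, reflect m c i ≤ m := fun i => Nat.sub_le _ _
  rw [eq_sub_iff_add_eq, ← val_const hq, val, val,
    ← (summable_val hq hr).tsum_add (summable_val hq hc), val]
  congr 1
  funext i
  simp only [reflect]
  rw [Nat.cast_sub (hc i)]
  ring

theorem val_split (hq : 1 < q) {c : ℕ → ℕ} (hc : ∀ i, c i ≤ m) (n : ℕ) :
    val q c = ∑ i ∈ Finset.range n, (c i : ℝ) / q ^ (i + 1) + val q (shift n c) / q ^ n := by
  have hq0 : 0 < q := by linarith
  rw [val, ← (summable_val hq hc).sum_add_tsum_nat_add n, val, ← tsum_div_const]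
  congr 2
  funext i
  simp only [shift]
  rw [add_comm i n, div_div, ← pow_add]
  congr 2; omega

theorem val_succ (hq : 1 < q) {c : ℕ → ℕ} (hc : ∀ i, c i ≤ m) (n : ℕ) :
    val q (shift (n + 1) c) = q * val q (shift n c) - c n := by
  have hq0 : 0 < q := by linarith
  have h := val_split (m := m) hq (c := shift n c) (fun i => hc _) 1
  rw [shift_shift] at h
  simp only [Finset.sum_range_one, zero_add, pow_one, shift, add_zero] at h
  rw [h]
  field_simp
  ring

theorem val_pos (hq : 1 < q) {c : ℕ → ℕ} (hc : ∀ i, c i ≤ m) {i : ℕ} (hi : c i ≠ 0) :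
    0 < val q c := by
  have hq0 : 0 < q := by linarith
  refine (summable_val hq hc).tsum_pos (fun i => by positivity) i ?_
  have : (0 : ℝ) < c i := by exact_mod_cast Nat.pos_of_ne_zero hi
  positivity

theorem val_splice (hq : 1 < q) {a e : ℕ → ℕ} (ha : ∀ j, a j ≤ m) {k : ℕ} (hk : k ≤ m)
    (he : ∀ j, e j ≤ m) (i : ℕ) :
    val q (splice a i k e) = val q a +
      (((k : ℝ) - a i) + (val q e - val q (shift (i + 1) a))) / q ^ (i + 1) := by
  rw [val_split hq (splice_le ha hk he) (i + 1), val_split hq ha (i + 1), shift_splice,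
    Finset.sum_range_succ, Finset.sum_range_succ]
  have h1 : ∑ j ∈ Finset.range i, (splice a i k e j : ℝ) / q ^ (j + 1)
      = ∑ j ∈ Finset.range i, (a j : ℝ) / q ^ (j + 1) := by
    refine Finset.sum_congr rfl fun j hj => ?_
    rw [splice, if_pos (Finset.mem_range.1 hj)]
  have h2 : splice a i k e i = k := by simp [splice]
  rw [h1, h2]
  ring

theorem exists_expansion (hq : 1 < q) (hqm : q ≤ m + 1) {x : ℝ} (hx0 : 0 ≤ x)
    (hx : x ≤ m / (q - 1)) : ∃ c : ℕ → ℕ, (∀ i, c i ≤ m) ∧ val q c = x := by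
  have hq0 : 0 < q := by linarith
  have hq1 : 0 < q - 1 := by linarith
  have hM : 1 ≤ (m : ℝ) / (q - 1) := by rw [le_div_iff₀ hq1]; linarith
  have hMq : q * ((m : ℝ) / (q - 1)) - m = m / (q - 1) := by field_simp; ring
  set dig : ℝ → ℕ := fun r => min m ⌊q * r⌋₊ with hdig
  set r : ℕ → ℝ := fun n => Nat.rec x (fun _ r => q * r - dig r) n with hr
  have hrs : ∀ n, r (n + 1) = q * r n - dig (r n) := fun n => rfl
  have hb : ∀ n, 0 ≤ r n ∧ r n ≤ m / (q - 1) := by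
    intro n
    induction n with
    | zero => exact ⟨hx0, hx⟩
    | succ n ih =>
      rw [hrs]
      have hnn : 0 ≤ q * r n := mul_nonneg hq0.le ih.1
      have hf := Nat.floor_le hnn
      rcases le_total m ⌊q * r n⌋₊ with h | h
      · have hd : dig (r n) = m := min_eq_left h
        rw [hd]
        have : (m : ℝ) ≤ ⌊q * r n⌋₊ := by exact_mod_cast h
        have := mul_le_mul_of_nonneg_left ih.2 hq0.le
        constructor <;> linarith
      · have hd : dig (r n) = ⌊q * r n⌋₊ := min_eq_right h
        rw [hd]
        have := Nat.lt_floor_add_one (q * r n)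
        constructor <;> linarith
  have hsum : ∀ n, ∑ i ∈ Finset.range n, (dig (r i) : ℝ) / q ^ (i + 1) = x - r n / q ^ n := by
    intro n
    induction n with
    | zero => simp [hr]
    | succ n ih =>
      rw [Finset.sum_range_succ, ih, hrs]
      field_simp
      ring
  have hc : ∀ i, dig (r i) ≤ m := fun i => min_le_left _ _
  refine ⟨fun i => dig (r i), hc, ?_⟩
  have h0 : Filter.Tendsto (fun n => r n / q ^ n) Filter.atTop (nhds 0) := by
    have hg : Filter.Tendsto (fun n : ℕ => (m : ℝ) / (q - 1) / q ^ n) Filter.atTop (nhds 0) :=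
      tendsto_const_nhds.div_atTop (tendsto_pow_atTop_atTop_of_one_lt hq)
    refine squeeze_zero (fun n => div_nonneg (hb n).1 (by positivity)) (fun n => ?_) hg
    have := (hb n).2
    gcongr
  have h1 : Filter.Tendsto (fun n => ∑ i ∈ Finset.range n, (dig (r i) : ℝ) / q ^ (i + 1))
      Filter.atTop (nhds x) := by
    simp only [hsum]
    simpa using h0.const_sub x
  exact tendsto_nhds_unique (summable_val hq hc).hasSum.tendsto_sum_nat h1

end Value

section Uniqueness

variable {m : ℕ} {q : ℝ} {γ : ℕ → ℕ}

theorem Admissible.exists_ne_zero (hγ : Admissible m γ) (k : ℕ) : ∃ i, shift k γ i ≠ 0 := by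
  by_contra! h
  obtain ⟨n, -, hn⟩ := hγ.reflect_lt k
  have := hγ.le n
  have := h n
  simp only [reflect] at hn
  omega

theorem Admissible.reflect_zero_lt (hγ : Admissible m γ) : m - γ 0 < γ 0 := by
  have hle : ∀ i, γ i ≤ γ 0 := by
    intro i
    by_contra! h
    exact not_lexLt_of_lexLe (hγ.shift_le i) ⟨0, by simp, by simpa [shift] using h⟩
  have hge : ∀ i, m - γ i ≤ γ 0 := by
    intro i
    by_contra! h
    exact lexLt_asymm (hγ.reflect_lt i) ⟨0, by simp, by simpa [shift, reflect] using h⟩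
  by_contra! h
  obtain ⟨n, -, hn⟩ := hγ.reflect_lt 0
  have := hle n
  have := hge n
  have := hγ.le n
  have := hγ.le 0
  simp only [reflect, shift, zero_add] at hn
  omega

theorem Admissible.zero_pos (hγ : Admissible m γ) : 0 < γ 0 := by
  have := hγ.reflect_zero_lt
  omega

theorem val_sub_one_le (hq : 1 < q) (hγ : ∀ i, γ i ≤ m) (h1 : val q γ = 1) {e : ℕ → ℕ}
    (he : ∀ i, e i ≤ m) {n : ℕ} (ha : ∀ i < n, e i = γ i) (hn : e n < γ n) :
    val q e - 1 ≤ (val q (shift (n + 1) e) - 1 - val q (shift (n + 1) γ)) / q ^ (n + 1) := by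
  have hq0 : 0 < q := by linarith
  have he' := val_split hq he (n + 1)
  have hγ' := val_split hq hγ (n + 1)
  rw [Finset.sum_range_succ] at he' hγ'
  rw [Finset.sum_congr rfl fun i hi => by rw [ha i (Finset.mem_range.1 hi)]] at he'
  have h2 : (e n : ℝ) + 1 ≤ γ n := by exact_mod_cast hn
  have h3 : (e n : ℝ) / q ^ (n + 1) + 1 / q ^ (n + 1) ≤ (γ n : ℝ) / q ^ (n + 1) := by
    rw [← add_div]; gcongr
  rw [sub_div, sub_div]
  linarith

theorem val_lt_one (hq : 1 < q) (hγ : Admissible m γ) (h1 : val q γ = 1) {e : ℕ → ℕ}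
    (he : ∀ i, e i ≤ m) (hadm : ∀ i, e i < m → lexLt (shift (i + 1) e) γ) (hlt : lexLt e γ) :
    val q e < 1 := by
  have hq0 : 0 < q := by linarith
  set C : ℝ := m / (q - 1) with hC
  have hC0 : 0 ≤ C := div_nonneg (by positivity) (by linarith)
  have key : ∀ N : ℕ, ∀ e : ℕ → ℕ, (∀ i, e i ≤ m) →
      (∀ i, e i < m → lexLt (shift (i + 1) e) γ) → lexLt e γ → val q e - 1 ≤ C / q ^ N := by
    intro N
    induction N with
    | zero =>
      intro e he _ _
      have := val_le hq he
      simp only [pow_zero, div_one]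
      linarith
    | succ N ih =>
      intro e he hadm hlt
      obtain ⟨n, ha, hn⟩ := hlt
      have h := val_sub_one_le hq hγ.le h1 he ha hn
      have h2 := ih (shift (n + 1) e) (fun i => he _)
        (fun i hi => by
          rw [shift_shift]
          exact hadm (n + 1 + i) hi) (hadm n (hn.trans_le (hγ.le n)))
      have h3 := val_nonneg hq (shift (n + 1) γ)
      have h4 : (val q (shift (n + 1) e) - 1 - val q (shift (n + 1) γ)) / q ^ (n + 1)
          ≤ (C / q ^ N) / q ^ (n + 1) := by gcongr; linarith
      have h5 : (C / q ^ N) / q ^ (n + 1) ≤ C / q ^ (N + 1) := by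
        rw [div_div, ← pow_add]
        have := pow_le_pow_right₀ hq.le (show N + 1 ≤ N + (n + 1) by omega)
        gcongr
      linarith
  have hle : ∀ e : ℕ → ℕ, (∀ i, e i ≤ m) →
      (∀ i, e i < m → lexLt (shift (i + 1) e) γ) → lexLt e γ → val q e ≤ 1 := by
    intro e he hadm hlt
    have hlim : Filter.Tendsto (fun n : ℕ => C / q ^ n) Filter.atTop (nhds 0) :=
      tendsto_const_nhds.div_atTop (tendsto_pow_atTop_atTop_of_one_lt hq)
    have := ge_of_tendsto' hlim fun N => key N e he hadm hlt
    linarith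
  obtain ⟨n, ha, hn⟩ := hlt
  have h := val_sub_one_le hq hγ.le h1 he ha hn
  have h2 := hle (shift (n + 1) e) (fun i => he _)
    (fun i hi => by
      rw [shift_shift]
      exact hadm (n + 1 + i) hi) (hadm n (hn.trans_le (hγ.le n)))
  obtain ⟨i, hi⟩ := hγ.exists_ne_zero (n + 1)
  have h3 : 0 < val q (shift (n + 1) γ) := val_pos hq (fun i => hγ.le _) hi
  have h4 : (val q (shift (n + 1) e) - 1 - val q (shift (n + 1) γ)) / q ^ (n + 1) < 0 :=
    div_neg_of_neg_of_pos (by linarith) (by positivity)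
  linarith

/-- The lexicographic criterion for unique expansions. -/
theorem isUnique_of_lexLt (hq : 1 < q) (hγ : Admissible m γ) (h1 : val q γ = 1) {c : ℕ → ℕ}
    (hc : ∀ i, c i ≤ m) (hup : ∀ i, c i < m → lexLt (shift (i + 1) c) γ)
    (hlow : ∀ i, 0 < c i → lexLt (reflect m (shift (i + 1) c)) γ) : IsUnique m q c := by
  have hq0 : 0 < q := by linarith
  have aux : ∀ a b : ℕ → ℕ, (∀ i, a i ≤ m) → (∀ i, b i ≤ m) → val q a = val q b → ∀ n,
      (∀ i < n, a i = b i) → a n < b n →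
      1 + val q (shift (n + 1) b) ≤ val q (shift (n + 1) a) := by
    intro a b ha hb hab n hn hlt
    rw [val_split hq ha (n + 1), val_split hq hb (n + 1), Finset.sum_range_succ,
      Finset.sum_range_succ,
      Finset.sum_congr rfl fun i hi => by rw [hn i (Finset.mem_range.1 hi)]] at hab
    have h2 : (a n : ℝ) + 1 ≤ b n := by exact_mod_cast hlt
    have h3 : ((a n : ℝ) + val q (shift (n + 1) a)) / q ^ (n + 1)
        = ((b n : ℝ) + val q (shift (n + 1) b)) / q ^ (n + 1) := by
      rw [add_div, add_div]; linarith
    rw [div_left_inj' (by positivity)] at h3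
    linarith
  intro d hd hdc
  by_contra hne
  rcases lexLt_or_lexLt hne with ⟨n, hn, hlt⟩ | ⟨n, hn, hlt⟩
  · have h := aux d c hd hc hdc n hn hlt
    have h2 := val_lt_one hq hγ h1 (e := reflect m (shift (n + 1) c)) (fun i => Nat.sub_le _ _)
      (fun i hi => by
        have := hlow (n + 1 + i) (by simp only [reflect, shift] at hi; omega)
        convert this using 1
        funext j
        simp only [reflect, shift]
        congr 2; omega) (hlow n (by omega))
    rw [val_reflect (c := shift (n + 1) c) hq fun i => hc _] at h2
    have h3 := val_le hq (c := shift (n + 1) d) fun i => hd _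
    linarith
  · have h := aux c d hc hd hdc.symm n hn hlt
    have h2 := val_lt_one hq hγ h1 (e := shift (n + 1) c) (fun i => hc _)
      (fun i hi => by
        rw [shift_shift]
        exact hup (n + 1 + i) hi) (hup n (hlt.trans_le (hd n)))
    have h3 := val_nonneg hq (shift (n + 1) d)
    linarith

theorem IsUnique.val_shift_lt_one (hq : 1 < q) (hqm : q ≤ m + 1) {α : ℕ → ℕ}
    (hα : ∀ i, α i ≤ m) (hu : IsUnique m q α) {i : ℕ} (hi : α i < m) :
    val q (shift (i + 1) α) < 1 := by
  by_contra! h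
  obtain ⟨e, he, hv⟩ := exists_expansion (m := m) hq hqm (x := val q (shift (i + 1) α) - 1)
    (by linarith) (by linarith [val_le hq (c := shift (i + 1) α) fun j => hα _])
  have h2 := hu (splice α i (α i + 1) e) (splice_le hα hi he) (by
    rw [val_splice hq hα hi he, hv]; push_cast; ring)
  have := congrFun h2 i
  simp [splice] at this

theorem IsUnique.lt_val_shift (hq : 1 < q) (hqm : q ≤ m + 1) {α : ℕ → ℕ}
    (hα : ∀ i, α i ≤ m) (hu : IsUnique m q α) {i : ℕ} (hi : 0 < α i) :
    m / (q - 1) - 1 < val q (shift (i + 1) α) := by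
  by_contra! h
  obtain ⟨e, he, hv⟩ := exists_expansion (m := m) hq hqm (x := val q (shift (i + 1) α) + 1)
    (by linarith [val_nonneg hq (shift (i + 1) α)]) (by linarith)
  have hk : α i - 1 ≤ m := (Nat.sub_le _ _).trans (hα i)
  have h2 := hu (splice α i (α i - 1) e) (splice_le hα hk he) (by
    rw [val_splice hq hα hk he, hv, Nat.cast_sub hi]; push_cast; ring)
  have := congrFun h2 i
  simp [splice] at this
  omega

theorem IsUnique.lexLe_of_val_le (hq : 1 < q) (hqm : q ≤ m + 1) {α : ℕ → ℕ}
    (hα : ∀ i, α i ≤ m) (hu : IsUnique m q α) {e : ℕ → ℕ} (he : ∀ i, e i ≤ m)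
    (h : val q e ≤ val q α) : lexLe e α := by
  have hq0 : 0 < q := by linarith
  refine lexLe_of_not_lexLt ?_
  rintro ⟨n, hn, hlt⟩
  have h1 := hu.val_shift_lt_one hq hqm hα (hlt.trans_le (he n))
  rw [val_split hq he (n + 1), val_split hq hα (n + 1), Finset.sum_range_succ,
      Finset.sum_range_succ,
      Finset.sum_congr rfl fun i hi => by rw [← hn i (Finset.mem_range.1 hi)]] at h
  have h2 : (α n : ℝ) + 1 ≤ e n := by exact_mod_cast hlt
  have h3 : ((e n : ℝ) + val q (shift (n + 1) e)) / q ^ (n + 1)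
      ≤ ((α n : ℝ) + val q (shift (n + 1) α)) / q ^ (n + 1) := by
    rw [add_div, add_div]; linarith
  rw [div_le_div_iff_of_pos_right (by positivity)] at h3
  linarith [val_nonneg hq (shift (n + 1) e)]

theorem IsUnique.lexLt_of_val_lt (hq : 1 < q) (hqm : q ≤ m + 1) {α : ℕ → ℕ}
    (hα : ∀ i, α i ≤ m) (hu : IsUnique m q α) {e : ℕ → ℕ} (he : ∀ i, e i ≤ m)
    (h : val q e < val q α) : lexLt e α := by
  rcases hu.lexLe_of_val_le hq hqm hα he h.le with h1 | rfl
  · exact h1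
  · exact absurd h (lt_irrefl _)

theorem IsUnique.admissible (hq : 1 < q) (hqm : q ≤ m + 1) {α : ℕ → ℕ} (hα : ∀ i, α i ≤ m)
    (hu : IsUnique m q α) (h1 : val q α = 1) :
    Admissible m α ∧ (m : ℝ) / (q - 1) < 2 := by
  have hq1 : 0 < q - 1 := by linarith
  have hle : ∀ i, val q (shift i α) ≤ 1 := by
    intro i
    induction i with
    | zero =>
      have : shift 0 α = α := by funext j; simp [shift]
      rw [this, h1]
    | succ i ih =>
      rcases (hα i).lt_or_eq with h | h
      · exact (hu.val_shift_lt_one hq hqm hα h).le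
      · rw [val_succ hq hα, h]
        nlinarith
  have hs0 : shift 0 α = α := by funext j; simp [shift]
  have hM : 1 ≤ (m : ℝ) / (q - 1) := by rw [le_div_iff₀ hq1]; linarith
  have hpos : 0 < α 0 := by
    by_contra! h
    have h2 := hle 1
    rw [show 1 = 0 + 1 from rfl, val_succ hq hα, hs0, h1, Nat.le_zero.1 h] at h2
    simp at h2
    linarith
  have hM2 : (m : ℝ) / (q - 1) < 2 := by
    have := hu.lt_val_shift hq hqm hα hpos
    have := hle (0 + 1)
    linarith
  have hge : ∀ i, m / (q - 1) - 1 < val q (shift i α) := by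
    intro i
    induction i with
    | zero => rw [hs0, h1]; linarith
    | succ i ih =>
      rcases Nat.eq_zero_or_pos (α i) with h | h
      · rw [val_succ hq hα, h]
        push_cast
        nlinarith
      · exact hu.lt_val_shift hq hqm hα h
  refine ⟨⟨hα, fun i => hu.lexLe_of_val_le hq hqm hα (fun j => hα _) (by rw [h1]; exact hle i),
    fun i => hu.lexLt_of_val_lt hq hqm hα (fun j => Nat.sub_le _ _) ?_⟩, hM2⟩
  rw [val_reflect (c := shift i α) hq fun j => hα _, h1]
  linarith [hge i]

theorem mem_B2_of_isUnique (hq : 1 < q) (hqm : q ≤ m + 1) (hm : 0 < m) {c d : ℕ → ℕ}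
    (hc : ∀ i, c i ≤ m) (hd : ∀ i, d i ≤ m) (huc : IsUnique m q c) (hud : IsUnique m q d)
    (hv : val q d = 1 + val q c) (hlt : val q c < 1) : q ∈ B2 m := by
  have hq0 : 0 < q := by linarith
  have hs : ∀ k e, shift 1 (splice 0 0 k e) = e := fun k e => shift_splice 0 0 k e
  have h0 : ∀ k e, splice 0 0 k e 0 = k := fun k e => by simp [splice]
  have hval : ∀ e : ℕ → ℕ, (∀ i, e i ≤ m) → val q e = (e 0 + val q (shift 1 e)) / q := by
    intro e he
    rw [val_split hq he 1]
    simp only [Finset.sum_range_one, zero_add, pow_one]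
    ring
  have hb := splice_le (i := 0) (a := 0) (fun _ => Nat.zero_le _) (Nat.zero_le m) hd
  have ha := splice_le (i := 0) (a := 0) (fun _ => Nat.zero_le _) hm hc
  have hvb : val q (splice 0 0 0 d) = val q d / q := by
    rw [hval _ hb, hs, h0]; simp
  have hva : val q (splice 0 0 1 c) = val q d / q := by
    rw [hval _ ha, hs, h0, hv]; simp
  refine ⟨⟨hq, hqm⟩, val q d / q, ⟨?_, ?_⟩, splice 0 0 0 d, splice 0 0 1 c, ?_, ⟨hb, hvb.symm⟩,
    ⟨ha, hva.symm⟩, ?_⟩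
  · exact div_nonneg (val_nonneg hq d) hq0.le
  · rw [← hvb]; exact val_le hq hb
  · intro h
    have := congrFun h 0
    rw [h0, h0] at this
    omega
  · rintro e ⟨he, hev⟩
    have hext : ∀ k g, e 0 = k → shift 1 e = g → e = splice 0 0 k g := by
      rintro k g rfl rfl
      funext j
      rcases j with _ | j
      · rw [h0]
      · simp [splice, shift, add_comm]
    change _ = val q e at hev
    rw [hval e he, div_left_inj' hq0.ne'] at hev
    have hnn := val_nonneg hq (shift 1 e)
    have hlt2 : e 0 < 2 := by
      have : (e 0 : ℝ) < 2 := by linarith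
      exact_mod_cast this
    have h01 : e 0 = 0 ∨ e 0 = 1 := by omega
    rcases h01 with h | h
    · left
      refine hext 0 d h (hud _ (fun i => he _) ?_)
      rw [h] at hev
      push_cast at hev
      linarith
    · right
      refine hext 1 c h (huc _ (fun i => he _) ?_)
      rw [h] at hev
      push_cast at hev
      linarith

theorem mem_Uset_iff : q ∈ Uset m ↔ 1 < q ∧ q ≤ m + 1 ∧
    ∃ α : ℕ → ℕ, (∀ i, α i ≤ m) ∧ val q α = 1 ∧ IsUnique m q α := by
  constructor
  · rintro ⟨⟨h1, h2⟩, -, α, ⟨hα, hv⟩, hu⟩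
    exact ⟨h1, h2, α, hα, hv.symm, fun d hd hdv => hu d ⟨hd, hv.trans hdv.symm⟩⟩
  · rintro ⟨h1, h2, α, hα, hv, hu⟩
    refine ⟨⟨h1, h2⟩, ⟨zero_le_one, hv ▸ val_le h1 hα⟩, α, ⟨hα, hv.symm⟩, ?_⟩
    rintro d ⟨hd, hdv⟩
    exact hu d hd (hdv.symm.trans hv.symm)

end Uniqueness

section Mirror

variable {m N : ℕ} {γ : ℕ → ℕ}

/-- No proper suffix of the first `N` digits of `γ` is the reflection of a prefix of `γ`. -/
def NoReflectedOverlap (m : ℕ) (γ : ℕ → ℕ) (N : ℕ) : Prop :=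
  ∀ i < N, PrefixLt (N - i) (reflect m (shift i γ)) γ

/-- The periodic sequence whose period is the reflection of the first `N` digits of `γ`,
with its last digit increased by one. -/
def mirror (m : ℕ) (γ : ℕ → ℕ) (N : ℕ) : ℕ → ℕ := fun i =>
  m - γ (i % N) + if i % N = N - 1 then 1 else 0

/-- The first `N` digits of `γ` followed by `mirror m γ N`. -/
def prefixMirror (m : ℕ) (γ : ℕ → ℕ) (N : ℕ) : ℕ → ℕ := fun i =>
  if i < N then γ i else mirror m γ N (i - N)

theorem lexLt_of_agree {a b : ℕ → ℕ} {k : ℕ} (h : ∀ i < k, a i = b i)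
    (hlt : lexLt (shift k a) (shift k b)) : lexLt a b := by
  obtain ⟨n, h1, h2⟩ := hlt
  refine ⟨k + n, fun i hi => ?_, h2⟩
  rcases lt_or_ge i k with hik | hik
  · exact h i hik
  · obtain ⟨s, rfl⟩ := Nat.exists_eq_add_of_le hik
    exact h1 s (by omega)

theorem prefixLt_of_agree {a b : ℕ → ℕ} {k t : ℕ} (h : ∀ i < k, a i = b i)
    (hlt : PrefixLt t (shift k a) (shift k b)) : PrefixLt (k + t) a b := by
  obtain ⟨n, hn, h1, h2⟩ := hlt
  refine ⟨k + n, by omega, fun i hi => ?_, h2⟩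
  rcases lt_or_ge i k with hik | hik
  · exact h i hik
  · obtain ⟨s, rfl⟩ := Nat.exists_eq_add_of_le hik
    exact h1 s (by omega)

theorem Admissible.exists_noReflectedOverlap (hγ : Admissible m γ) (K : ℕ) :
    ∃ N ≥ K, NoReflectedOverlap m γ N := by
  classical
  by_cases hK : NoReflectedOverlap m γ K
  · exact ⟨K, le_rfl, hK⟩
  have agree : ∀ N i, ¬ PrefixLt (N - i) (reflect m (shift i γ)) γ →
      ∀ j < N - i, m - γ (i + j) = γ j := fun N i h =>
    (prefixLt_or_agree (Or.inl (hγ.reflect_lt i)) (N - i)).resolve_left h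
  have hex : ∃ i, i < K ∧ ∀ j < K - i, m - γ (i + j) = γ j := by
    unfold NoReflectedOverlap at hK
    push Not at hK
    obtain ⟨i, hi, h⟩ := hK
    exact ⟨i, hi, agree K i h⟩
  obtain ⟨hiK, hi⟩ := Nat.find_spec hex
  have hmin : ∀ j < Nat.find hex, ¬ (j < K ∧ ∀ k < K - j, m - γ (j + k) = γ k) :=
    fun j hj => Nat.find_min hex hj
  generalize Nat.find hex = i at hiK hi hmin
  obtain ⟨n, hn, hlt⟩ := hγ.reflect_lt i
  simp only [reflect, shift] at hn hlt
  have hnK : K - i ≤ n := by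
    by_contra! h
    have := hi n h
    omega
  refine ⟨i + n + 1, by omega, fun j hj => ?_⟩
  by_contra hbad
  have hag := agree _ j hbad
  rcases lt_trichotomy j i with h | rfl | h
  · exact hmin j h ⟨by omega, fun k hk => hag k (by omega)⟩
  · have := hag n (by omega)
    omega
  · obtain ⟨r, rfl⟩ := Nat.exists_eq_add_of_le h.le
    refine not_lexLt_of_lexLe (hγ.shift_le r) ⟨n - r, fun k hk => ?_, ?_⟩
    · have h1 := hag k (by omega)
      have h2 := hn (r + k) (by omega)
      rw [← add_assoc] at h2
      simp only [shift]
      omega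
    · have h1 := hag (n - r) (by omega)
      rw [show i + r + (n - r) = i + n by omega] at h1
      simp only [shift]
      rw [show r + (n - r) = n by omega]
      omega

theorem NoReflectedOverlap.last_pos (hN : NoReflectedOverlap m γ N) (hγ : ∀ i, γ i ≤ m)
    (hN0 : 0 < N) : 0 < γ (N - 1) := by
  obtain ⟨n, hn, -, h⟩ := hN (N - 1) (by omega)
  have : n = 0 := by omega
  subst this
  have := hγ 0
  simp only [reflect, shift, add_zero] at h
  omega

theorem mirror_of_lt {i : ℕ} (hi : i < N - 1) : mirror m γ N i = m - γ i := by
  have : i % N = i := Nat.mod_eq_of_lt (by omega)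
  simp only [mirror, this]
  rw [if_neg (by omega), add_zero]

theorem mirror_last (hN0 : 0 < N) : mirror m γ N (N - 1) = m - γ (N - 1) + 1 := by
  have : (N - 1) % N = N - 1 := Nat.mod_eq_of_lt (by omega)
  simp only [mirror, this, if_true]

theorem mirror_add (i : ℕ) : mirror m γ N (N + i) = mirror m γ N i := by
  simp only [mirror, Nat.add_mod_left]

theorem shift_mirror_mod (j : ℕ) : shift j (mirror m γ N) = shift (j % N) (mirror m γ N) := by
  funext i
  simp only [shift, mirror, Nat.mod_add_mod]

theorem mirror_le (hN : NoReflectedOverlap m γ N) (hγ : ∀ i, γ i ≤ m) (hN0 : 0 < N) (i : ℕ) :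
    mirror m γ N i ≤ m := by
  have h1 := hN.last_pos hγ hN0
  have h2 := hγ (i % N)
  simp only [mirror]
  split_ifs with h
  · rw [h] at h2 ⊢; omega
  · omega

theorem mirror_lt_shift (hN : NoReflectedOverlap m γ N) (hγ : ∀ i, γ i ≤ m) {t : ℕ}
    (ht : 0 < t) (htN : t < N) : PrefixLt t (mirror m γ N) (shift (N - t) γ) := by
  obtain ⟨r, hr, h1, h2⟩ := hN (N - t) (by omega)
  refine ⟨r, by omega, fun s hs => ?_, ?_⟩
  · have h3 := h1 s hs
    have := hγ (N - t + s)
    rw [mirror_of_lt (by omega)]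
    simp only [reflect, shift] at h3 ⊢
    omega
  · have := hγ r
    rw [mirror_of_lt (by omega)]
    simp only [reflect, shift] at h2 ⊢
    omega

theorem reflect_shift_mirror_lt (hγ : Admissible m γ) (hN : NoReflectedOverlap m γ N)
    (hN0 : 0 < N) (j : ℕ) : PrefixLt N (reflect m (shift j (mirror m γ N))) γ := by
  rw [shift_mirror_mod]
  have hj : j % N < N := Nat.mod_lt _ hN0
  generalize j % N = j at hj
  have hdig : ∀ i < N - j - 1, reflect m (shift j (mirror m γ N)) i = shift j γ i := by
    intro i hi
    have := hγ.le (j + i)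
    simp only [reflect, shift]
    rw [mirror_of_lt (by omega)]
    omega
  have hlast : reflect m (shift j (mirror m γ N)) (N - j - 1) < shift j γ (N - j - 1) := by
    have := hN.last_pos hγ.le hN0
    have := hγ.le (N - 1)
    simp only [reflect, shift]
    rw [show j + (N - j - 1) = N - 1 by omega, mirror_last hN0]
    omega
  rcases prefixLt_or_agree (hγ.shift_le j) (N - j - 1) with ⟨n, hn, h1, h2⟩ | h
  · refine ⟨n, by omega, fun i hi => ?_, ?_⟩
    · rw [hdig i (by omega), h1 i hi]
    · rw [hdig n hn]; exact h2
  · refine ⟨N - j - 1, by omega, fun i hi => ?_, ?_⟩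
    · rw [hdig i hi, h i hi]
    · have : shift j γ (N - j - 1) ≤ γ (N - j - 1) := by
        by_contra! h3
        exact not_lexLt_of_lexLe (hγ.shift_le j) ⟨_, fun i hi => (h i hi).symm, h3⟩
      omega

theorem shift_mirror_lt (hγ : Admissible m γ) (hN : NoReflectedOverlap m γ N)
    (hN2 : 2 ≤ N) (j : ℕ) : PrefixLt N (shift j (mirror m γ N)) γ := by
  rw [shift_mirror_mod]
  have hj : j % N < N := Nat.mod_lt _ (by omega)
  generalize j % N = j at hj
  rcases Nat.eq_zero_or_pos j with rfl | hj0
  · refine ⟨0, by omega, by simp, ?_⟩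
    simp only [shift]
    rw [mirror_of_lt (by omega)]
    exact hγ.reflect_zero_lt
  · have hdig : ∀ i < N - j - 1, shift j (mirror m γ N) i = m - γ (j + i) := by
      intro i hi
      simp only [shift]
      rw [mirror_of_lt (by omega)]
    have hlast : shift j (mirror m γ N) (N - j - 1) = m - γ (N - 1) + 1 := by
      simp only [shift]
      rw [show j + (N - j - 1) = N - 1 by omega, mirror_last (by omega)]
    obtain ⟨n, hn, h1, h2⟩ := hN j hj
    simp only [reflect, shift] at h1 h2
    have hag : ∀ i < n, shift j (mirror m γ N) i = γ i := fun i hi => by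
      rw [hdig i (by omega), h1 i hi]
    rcases lt_or_ge n (N - j - 1) with hn1 | hn1
    · exact ⟨n, by omega, hag, by rw [hdig n hn1]; exact h2⟩
    · obtain rfl : n = N - j - 1 := by omega
      rw [show j + (N - j - 1) = N - 1 by omega] at h2
      rcases (Nat.succ_le_of_lt h2).lt_or_eq with h3 | h3
      · exact ⟨N - j - 1, by omega, hag, by rw [hlast]; exact h3⟩
      · have h4 : PrefixLt (N - j + j) (shift j (mirror m γ N)) γ := by
          refine prefixLt_of_agree (k := N - j) (fun i hi => ?_) ?_
          · rcases lt_or_ge i (N - j - 1) with h5 | h5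
            · exact hag i h5
            · obtain rfl : i = N - j - 1 := by omega
              rw [hlast]; exact h3
          · refine (mirror_lt_shift hN hγ.le hj0 hj).congr (fun i _ => ?_) fun _ _ => rfl
            simp only [shift]
            rw [show j + (N - j + i) = N + i by omega, mirror_add]
        rwa [Nat.sub_add_cancel hj.le] at h4

theorem prefixMirror_of_lt {i : ℕ} (hi : i < N) : prefixMirror m γ N i = γ i := if_pos hi

theorem shift_prefixMirror (j : ℕ) :
    shift (N + j) (prefixMirror m γ N) = shift j (mirror m γ N) := by
  funext i
  simp only [shift, prefixMirror]
  rw [if_neg (by omega)]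
  congr 1; omega

theorem shift_prefixMirror_lt (hγ : Admissible m γ) (hN : NoReflectedOverlap m γ N)
    (hN2 : 2 ≤ N) {t : ℕ} (ht : 0 < t) :
    lexLt (shift t (prefixMirror m γ N)) (prefixMirror m γ N) := by
  rcases lt_or_ge t N with htN | htN
  · have h4 : PrefixLt (N - t + t) (shift t (prefixMirror m γ N)) γ := by
      have hdig : ∀ i < N - t, shift t (prefixMirror m γ N) i = shift t γ i := fun i hi => by
        simp only [shift]
        exact prefixMirror_of_lt (by omega)
      rcases prefixLt_or_agree (hγ.shift_le t) (N - t) with ⟨n, hn, h1, h2⟩ | h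
      · exact ⟨n, by omega, fun i hi => by rw [hdig i (by omega), h1 i hi],
          by rw [hdig n hn]; exact h2⟩
      · refine prefixLt_of_agree (k := N - t) (fun i hi => by rw [hdig i hi, h i hi]) ?_
        refine (mirror_lt_shift hN hγ.le ht htN).congr (fun i _ => ?_) fun _ _ => rfl
        rw [shift_shift, show t + (N - t) = N + 0 by omega, shift_prefixMirror]
        simp [shift]
    rw [Nat.sub_add_cancel htN.le] at h4
    exact (h4.congr (fun _ _ => rfl) fun i hi => prefixMirror_of_lt hi).lexLt
  · obtain ⟨j, rfl⟩ := Nat.exists_eq_add_of_le htN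
    rw [shift_prefixMirror]
    exact ((shift_mirror_lt hγ hN hN2 j).congr (fun _ _ => rfl)
      fun i hi => prefixMirror_of_lt hi).lexLt

theorem admissible_prefixMirror (hγ : Admissible m γ) (hN : NoReflectedOverlap m γ N)
    (hN2 : 2 ≤ N) : Admissible m (prefixMirror m γ N) := by
  refine ⟨fun i => ?_, fun t => ?_, fun t => ?_⟩
  · simp only [prefixMirror]
    split_ifs
    · exact hγ.le i
    · exact mirror_le hN hγ.le (by omega) _
  · rcases Nat.eq_zero_or_pos t with rfl | ht
    · exact Or.inr (by funext i; simp [shift])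
    · exact Or.inl (shift_prefixMirror_lt hγ hN hN2 ht)
  · rcases lt_or_ge t N with htN | htN
    · refine ((hN t htN).congr (fun i hi => ?_) fun i hi => prefixMirror_of_lt (by omega)).lexLt
      simp only [reflect, shift]
      rw [prefixMirror_of_lt (by omega)]
    · obtain ⟨j, rfl⟩ := Nat.exists_eq_add_of_le htN
      rw [shift_prefixMirror]
      exact ((reflect_shift_mirror_lt hγ hN (by omega) j).congr (fun _ _ => rfl)
        fun i hi => prefixMirror_of_lt hi).lexLt

theorem prefixMirror_ne (hγ : Admissible m γ) {N' : ℕ} (hN : NoReflectedOverlap m γ N)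
    (hN0 : 0 < N) (hNN' : N < N') (h : prefixMirror m γ N = γ) :
    prefixMirror m γ N' ≠ γ := by
  intro h'
  have h1 : shift N' γ = shift (N' - N) (mirror m γ N) := by
    rw [← shift_prefixMirror, h, Nat.add_sub_cancel' hNN'.le]
  have h2 : shift N' γ = shift 0 (mirror m γ N') := by
    rw [← shift_prefixMirror, h', add_zero]
  obtain ⟨n, hn, -, hlt⟩ := reflect_shift_mirror_lt hγ hN hN0 (N' - N)
  rw [← h1, h2] at hlt
  have := hγ.le n
  simp only [reflect, shift, zero_add] at hlt
  rw [mirror_of_lt (by omega)] at hlt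
  omega

theorem mem_Uset_of_admissible {p : ℝ} (hp : 1 < p) (hpm : p ≤ m + 1) (hγ : Admissible m γ)
    (h1 : val p γ = 1) (h : ∀ i, γ i < m → lexLt (shift (i + 1) γ) γ) : p ∈ Uset m :=
  mem_Uset_iff.2 ⟨hp, hpm, γ, hγ.le, h1,
    isUnique_of_lexLt hp hγ h1 hγ.le h fun i _ => hγ.reflect_lt (i + 1)⟩

end Mirror

section MemB2

variable {m : ℕ} {q : ℝ} {γ : ℕ → ℕ}

theorem val_zero (q : ℝ) : val q 0 = 0 := by simp [val]

theorem Uset_subset_B2 (hm : 0 < m) : Uset m ⊆ B2 m := by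
  intro q hq
  obtain ⟨h1, h2, α, hα, hv, hu⟩ := mem_Uset_iff.1 hq
  obtain ⟨hadm, -⟩ := hu.admissible h1 h2 hα hv
  have hz : IsUnique m q 0 := isUnique_of_lexLt h1 hadm hv (fun _ => Nat.zero_le _)
    (fun i _ => ⟨0, by simp, by simpa [shift] using hadm.zero_pos⟩) (by simp)
  refine mem_B2_of_isUnique (c := 0) h1 h2 hm (fun _ => Nat.zero_le _) hα hz hu ?_ ?_
  · rw [hv, val_zero, add_zero]
  · rw [val_zero]; exact one_pos

theorem Admissible.exists_prefix_lt_shift (hγ : Admissible m γ) (p : ℕ) : ∃ N,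
    2 ≤ N ∧ NoReflectedOverlap m γ N ∧ ∀ k ≤ p, lexLt (mirror m γ N) (shift k γ) := by
  choose f hf hf' using hγ.reflect_lt
  obtain ⟨N, hN, hgood⟩ :=
    hγ.exists_noReflectedOverlap ((Finset.range (p + 1)).sup f + 2)
  refine ⟨N, by omega, hgood, fun k hk => ?_⟩
  have hle : f k ≤ (Finset.range (p + 1)).sup f :=
    Finset.le_sup (Finset.mem_range.2 (by omega))
  refine ⟨f k, fun i hi => ?_, ?_⟩
  · have := hf k i hi
    have := hγ.le (k + i)
    rw [mirror_of_lt (by omega)]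
    simp only [reflect, shift] at *
    omega
  · have := hf' k
    have := hγ.le (f k)
    rw [mirror_of_lt (by omega)]
    simp only [reflect, shift] at *
    omega

theorem shift_splice_of_ge {a c : ℕ → ℕ} {i k p : ℕ} (h : p ≤ i) :
    shift (i + 1) (splice a p k c) = shift (i - p) c := by
  rw [show i + 1 = p + 1 + (i - p) by omega, ← shift_shift, shift_splice]

theorem mem_B2_of_periodic (hq : 1 < q) (hqm : q ≤ m + 1) (hγ : Admissible m γ)
    (h1 : val q γ = 1) (hper : ∃ i, γ i < m ∧ shift (i + 1) γ = γ) : q ∈ B2 m := by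
  classical
  obtain ⟨hpm, hp⟩ := Nat.find_spec hper
  have hmin : ∀ r < Nat.find hper, ¬ (γ r < m ∧ shift (r + 1) γ = γ) :=
    fun r hr => Nat.find_min hper hr
  generalize Nat.find hper = p at hpm hp hmin
  obtain ⟨N, hN2, hN, hkey⟩ := hγ.exists_prefix_lt_shift p
  have hup := shift_mirror_lt hγ hN hN2
  have hlow := reflect_shift_mirror_lt hγ hN (by omega)
  have hc := mirror_le hN hγ.le (by omega)
  set c := mirror m γ N with hcdef
  have he := splice_le (i := p) (a := 0) (fun _ => Nat.zero_le _) (Nat.zero_le m) hc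
  have hd := splice_le (i := p) hγ.le (Nat.succ_le_of_lt hpm) hc
  have he0 : ∀ i ≤ p, splice 0 p 0 c i = 0 := by
    intro i hi
    simp only [splice, Pi.zero_apply]
    split_ifs
    · rfl
    · rfl
    · omega
  have heup : ∀ i, splice 0 p 0 c i < m → lexLt (shift (i + 1) (splice 0 p 0 c)) γ := by
    intro i _
    rcases lt_or_ge i p with h | h
    · exact ⟨0, by simp, by simpa [shift, he0 (i + 1) h] using hγ.zero_pos⟩
    · rw [shift_splice_of_ge h]; exact (hup _).lexLt
  have hue : IsUnique m q (splice 0 p 0 c) := by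
    refine isUnique_of_lexLt hq hγ h1 he heup fun i hi => ?_
    have h : p ≤ i := by
      by_contra! h
      rw [he0 i h.le] at hi
      omega
    rw [shift_splice_of_ge h]; exact (hlow _).lexLt
  have hdlt : ∀ i < p, splice γ p (γ p + 1) c i = γ i := fun i hi => by
    rw [splice, if_pos hi]
  have hdp : splice γ p (γ p + 1) c p = γ p + 1 := by simp [splice]
  have hud : IsUnique m q (splice γ p (γ p + 1) c) := by
    refine isUnique_of_lexLt hq hγ h1 hd (fun i _ => ?_) fun i _ => ?_
    · rcases lt_or_ge i p with h | h
      swap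
      · rw [shift_splice_of_ge h]; exact (hup _).lexLt
      have hdig : ∀ s < p - i - 1,
          shift (i + 1) (splice γ p (γ p + 1) c) s = γ (i + 1 + s) := fun s hs => by
        simp only [shift]; exact hdlt _ (by omega)
      have hlast : shift (i + 1) (splice γ p (γ p + 1) c) (p - i - 1) = γ p + 1 := by
        simp only [shift]
        rw [show i + 1 + (p - i - 1) = p by omega, hdp]
      rcases prefixLt_or_agree (hγ.shift_le (i + 1)) (p - i) with ⟨n, hn, ha, hlt⟩ | hag
      · simp only [shift] at ha hlt
        rcases lt_or_ge n (p - i - 1) with hn1 | hn1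
        · exact ⟨n, fun s hs => by rw [hdig s (by omega), ha s hs],
            by rw [hdig n hn1]; exact hlt⟩
        · obtain rfl : n = p - i - 1 := by omega
          have ha' : ∀ s < p - i - 1, shift (i + 1) (splice γ p (γ p + 1) c) s = γ s :=
            fun s hs => by rw [hdig s hs, ha s hs]
          rw [show i + 1 + (p - i - 1) = p by omega] at hlt
          rcases (Nat.succ_le_of_lt hlt).lt_or_eq with h3 | h3
          · exact ⟨_, ha', by rw [hlast]; exact h3⟩
          · refine lexLt_of_agree (k := p - i) (fun s hs => ?_) ?_
            · rcases lt_or_ge s (p - i - 1) with h5 | h5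
              · exact ha' s h5
              · obtain rfl : s = p - i - 1 := by omega
                rw [hlast]; exact h3
            · rw [shift_shift, show i + 1 + (p - i) = p + 1 by omega, shift_splice]
              exact hkey _ (by omega)
      · exfalso
        simp only [shift] at hag
        refine hmin (p - i - 1) (by omega) ⟨?_, ?_⟩
        · rw [← hag _ (by omega), show i + 1 + (p - i - 1) = p by omega]; exact hpm
        · rw [show p - i - 1 + 1 = p - i by omega]
          rcases hγ.shift_le (p - i) with hlt | heq
          · refine absurd (lexLt_of_agree (b := shift (i + 1) γ) (k := p - i) (fun s hs => (hag s hs).symm) ?_)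
              (not_lexLt_of_lexLe (hγ.shift_le (i + 1)))
            rw [shift_shift, show i + 1 + (p - i) = p + 1 by omega, hp]
            exact hlt
          · exact heq
    · rcases lt_or_ge i p with h | h
      swap
      · rw [shift_splice_of_ge h]; exact (hlow _).lexLt
      have hdig : ∀ s < p - i - 1, reflect m (shift (i + 1) (splice γ p (γ p + 1) c)) s
          = reflect m (shift (i + 1) γ) s := fun s hs => by
        simp only [reflect, shift]; rw [hdlt _ (by omega)]
      have hlast : reflect m (shift (i + 1) (splice γ p (γ p + 1) c)) (p - i - 1)
          < reflect m (shift (i + 1) γ) (p - i - 1) := by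
        simp only [reflect, shift]
        rw [show i + 1 + (p - i - 1) = p by omega, hdp]
        omega
      have hw := hγ.reflect_lt (i + 1)
      rcases prefixLt_or_agree (Or.inl hw) (p - i - 1) with ⟨n, hn, ha, hlt⟩ | hag
      · exact ⟨n, fun s hs => by rw [hdig s (by omega), ha s hs],
          by rw [hdig n hn]; exact hlt⟩
      · refine ⟨p - i - 1, fun s hs => by rw [hdig s hs, hag s hs], hlast.trans_le ?_⟩
        by_contra! h3
        exact lexLt_asymm hw ⟨_, fun s hs => (hag s hs).symm, h3⟩
  have hve : val q (splice 0 p 0 c) = val q c / q ^ (p + 1) := by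
    rw [val_splice (m := m) (a := 0) hq (fun _ => Nat.zero_le _) (Nat.zero_le m) hc,
      show shift (p + 1) (0 : ℕ → ℕ) = 0 from rfl, val_zero]
    simp
  refine mem_B2_of_isUnique hq hqm (by omega) he hd hue hud ?_ ?_
  · rw [val_splice hq hγ.le (Nat.succ_le_of_lt hpm) hc, hp, h1, hve]
    push_cast
    ring
  · exact val_lt_one hq hγ h1 he heup
      ⟨0, by simp, by rw [he0 0 (Nat.zero_le p)]; exact hγ.zero_pos⟩

end MemB2

section Topology

open Filter Topology

variable {m : ℕ} {q : ℝ} {γ : ℕ → ℕ}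

theorem eventually_agree {ι : Type*} {l : Filter ι} {α : ι → ℕ → ℕ}
    (h : Tendsto α l (𝓝 γ)) (n : ℕ) : ∀ᶠ k in l, ∀ i < n, α k i = γ i := by
  refine (eventually_all_finite (Set.finite_Iio n)).2 fun i _ => ?_
  have := tendsto_pi_nhds.1 h i
  rw [nhds_discrete] at this
  exact tendsto_pure.1 this

theorem tendsto_val {ι : Type*} {l : Filter ι} {u : ι → ℝ} {α : ι → ℕ → ℕ} {r : ℝ}
    (hr : 1 < r) (hu : ∀ k, r ≤ u k) (hα : ∀ k i, α k i ≤ m) (huq : Tendsto u l (𝓝 q))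
    (hαγ : Tendsto α l (𝓝 γ)) (hq : r ≤ q) :
    Tendsto (fun k => val (u k) (α k)) l (𝓝 (val q γ)) := by
  have hr0 : 0 < r := by linarith
  refine tendsto_tsum_of_dominated_convergence
    (bound := fun i => (m : ℝ) / r ^ (i + 1)) (summable_val hr fun _ => le_rfl) (fun i => ?_)
    (Eventually.of_forall fun k i => ?_)
  · refine Tendsto.div ?_ (huq.pow _) (pow_ne_zero _ (by linarith))
    refine tendsto_const_nhds.congr' ?_
    filter_upwards [eventually_agree hαγ (i + 1)] with k hk
    rw [hk i (Nat.lt_succ_self i)]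
  · have h0 : 0 < u k := hr0.trans_le (hu k)
    rw [Real.norm_of_nonneg (by positivity)]
    have h1 : (α k i : ℝ) ≤ m := by exact_mod_cast hα k i
    have := hu k
    gcongr

/-- If `γ` is the reflection of its shift by `n`, then no other sequence subject to the weak
lexicographic conditions shares its first `2 * n` digits. -/
theorem eq_of_agree_of_reflect_shift_eq {α : ℕ → ℕ} (hα : Admissible m α)
    (hγ : ∀ i, γ i ≤ m) {n : ℕ} (hn : 0 < n) (h : reflect m (shift n γ) = γ)
    (hag : ∀ i < 2 * n, α i = γ i) : α = γ := by
  have hrefl : ∀ i, m - γ (n + i) = γ i := fun i => congrFun h i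
  by_contra hne
  rcases lexLt_or_lexLt hne with ⟨k, h1, h2⟩ | ⟨k, h1, h2⟩
  · have hk : 2 * n ≤ k := by
      by_contra! hk
      have := hag k hk
      omega
    obtain ⟨s, rfl⟩ := Nat.exists_eq_add_of_le (show n ≤ k by omega)
    refine lexLt_asymm (hα.reflect_lt n) ⟨s, fun i hi => ?_, ?_⟩
    · have := h1 (n + i) (by omega)
      have := h1 i (by omega)
      have := hrefl i
      simp only [reflect, shift]
      omega
    · have := h1 s (by omega)
      have := hrefl s
      have := hγ (n + s)
      simp only [reflect, shift]
      omega
  · have hk : 2 * n ≤ k := by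
      by_contra! hk
      have := hag k hk
      omega
    obtain ⟨s, rfl⟩ := Nat.exists_eq_add_of_le hk
    have hper : ∀ i, γ (2 * n + i) = γ i := by
      intro i
      have h3 := hrefl i
      have h4 := hrefl (n + i)
      have := hγ i
      have := hγ (n + i)
      have := hγ (n + (n + i))
      rw [show 2 * n + i = n + (n + i) by ring]
      omega
    refine not_lexLt_of_lexLe (hα.shift_le (2 * n)) ⟨s, fun i hi => ?_, ?_⟩
    · have := h1 (2 * n + i) (by omega)
      have := h1 i (by omega)
      have := hper i
      simp only [shift]
      omega
    · have := h1 s (by omega)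
      have := hper s
      simp only [shift]
      omega

theorem exists_admissible_of_mem_closure (hq : q ∈ closure (Uset m)) :
    1 < q ∧ q ≤ m + 1 ∧ ∃ γ, Admissible m γ ∧ val q γ = 1 := by
  obtain ⟨u, hu, hlim⟩ := mem_closure_iff_seq_limit.1 hq
  choose hu1 hum α hα hv huniq using fun k => mem_Uset_iff.1 (hu k)
  have hadm := fun k => ((huniq k).admissible (hu1 k) (hum k) (hα k) (hv k)).1
  have hm : 0 < m := (hadm 0).zero_pos.trans_le ((hadm 0).le 0)
  set r : ℝ := 1 + m / 2 with hr
  have hr1 : 1 < r := by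
    have : (0 : ℝ) < m := by exact_mod_cast hm
    rw [hr]; linarith
  have hru : ∀ k, r ≤ u k := by
    intro k
    have h := ((huniq k).admissible (hu1 k) (hum k) (hα k) (hv k)).2
    rw [div_lt_iff₀ (by linarith [hu1 k])] at h
    linarith
  have hrq : r ≤ q := ge_of_tendsto' hlim hru
  have hK : IsCompact (Set.univ.pi fun _ : ℕ => Set.Iic m) :=
    isCompact_univ_pi fun _ => (Set.finite_Iic m).isCompact
  obtain ⟨γ, hγ, φ, hφ, hconv⟩ := hK.tendsto_subseq (x := α) fun k i _ => hα k i
  have hγm : ∀ i, γ i ≤ m := fun i => hγ i trivial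
  have hag := fun n => (eventually_agree hconv n).exists
  have hle : ∀ i, lexLe (shift i γ) γ := by
    intro i
    refine lexLe_of_not_lexLt fun ⟨n, h1, h2⟩ => ?_
    obtain ⟨k, hk⟩ := hag (i + n + 1)
    simp only [Function.comp] at hk
    refine not_lexLt_of_lexLe ((hadm (φ k)).shift_le i) ⟨n, fun j hj => ?_, ?_⟩
    · simp only [shift] at h1 ⊢
      rw [hk j (by omega), hk (i + j) (by omega), h1 j hj]
    · simp only [shift] at h2 ⊢
      rw [hk n (by omega), hk (i + n) (by omega)]
      exact h2
  have hrle : ∀ i, lexLe (reflect m (shift i γ)) γ := by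
    intro i
    refine lexLe_of_not_lexLt fun ⟨n, h1, h2⟩ => ?_
    obtain ⟨k, hk⟩ := hag (i + n + 1)
    simp only [Function.comp] at hk
    refine lexLt_asymm ((hadm (φ k)).reflect_lt i) ⟨n, fun j hj => ?_, ?_⟩
    · simp only [reflect, shift] at h1 ⊢
      rw [hk j (by omega), hk (i + j) (by omega), h1 j hj]
    · simp only [reflect, shift] at h2 ⊢
      rw [hk n (by omega), hk (i + n) (by omega)]
      exact h2
  have hne : ∀ n, 0 < n → reflect m (shift n γ) ≠ γ := by
    intro n hn h
    obtain ⟨k, hk⟩ := hag (2 * n)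
    have heq := eq_of_agree_of_reflect_shift_eq (hadm (φ k)) hγm hn h hk
    have := (hadm (φ k)).reflect_lt n
    rw [heq, h] at this
    exact lexLt_irrefl _ this
  refine ⟨hr1.trans_le hrq, le_of_tendsto' hlim hum, γ, ⟨hγm, hle, fun n => ?_⟩, ?_⟩
  · refine (hrle n).resolve_right fun h => ?_
    rcases Nat.eq_zero_or_pos n with rfl | hn
    · refine hne 1 one_pos (funext fun i => ?_)
      have hg : ∀ i, m - γ i = γ i := fun i => by
        simpa [reflect, shift] using congrFun h i
      have := hg (1 + i)
      have := hg i
      have := hγm i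
      have := hγm (1 + i)
      simp only [reflect, shift]
      omega
    · exact hne n hn h
  · have h1 := tendsto_val hr1 (fun k => hru (φ k)) (fun k => hα (φ k))
      (hlim.comp hφ.tendsto_atTop) hconv hrq
    have h2 : (fun k => val (u (φ k)) (α (φ k))) = fun _ => 1 := funext fun k => hv (φ k)
    exact tendsto_nhds_unique h1 (h2 ▸ tendsto_const_nhds)

theorem closure_Uset_subset_B2 (hm : 0 < m) : closure (Uset m) ⊆ B2 m := by
  intro q hq
  obtain ⟨h1, hqm, γ, hγ, hv⟩ := exists_admissible_of_mem_closure hq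
  by_cases hper : ∃ i, γ i < m ∧ shift (i + 1) γ = γ
  · exact mem_B2_of_periodic h1 hqm hγ hv hper
  · push Not at hper
    exact Uset_subset_B2 hm (mem_Uset_of_admissible h1 hqm hγ hv fun i hi =>
      (hγ.shift_le (i + 1)).resolve_right (hper i hi))

theorem continuousOn_val {a : ℝ} (ha : 1 < a) {c : ℕ → ℕ} (hc : ∀ i, c i ≤ m) :
    ContinuousOn (fun p => val p c) (Set.Ici a) := by
  refine continuousOn_tsum (u := fun i => (m : ℝ) / a ^ (i + 1)) (fun i => ?_)
    (summable_val ha fun _ => le_rfl) fun i p hp => ?_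
  · refine continuousOn_const.div (continuousOn_id.pow _) fun p hp => pow_ne_zero _ ?_
    have : a ≤ p := hp
    exact (by linarith : (0 : ℝ) < p).ne'
  · have hp' : a ≤ p := hp
    have h0 : 0 < a := by linarith
    have h0' : 0 < p := by linarith
    rw [Real.norm_of_nonneg (by positivity)]
    have h1 : (c i : ℝ) ≤ m := by exact_mod_cast hc i
    gcongr

theorem val_lt_val {a b : ℝ} (ha : 1 < a) (hab : a < b) {c : ℕ → ℕ} (hc : ∀ i, c i ≤ m)
    (h0 : 0 < c 0) : val b c < val a c := by
  have ha0 : 0 < a := by linarith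
  refine Summable.tsum_lt_tsum (i := 0) (fun i => ?_) ?_ (summable_val (ha.trans hab) hc)
    (summable_val ha hc)
  · gcongr
  · have : (0 : ℝ) < c 0 := by exact_mod_cast h0
    simp only [zero_add, pow_one]
    gcongr

theorem eventually_lt_val {a : ℝ} (ha : 1 < a) {α : ℕ → ℕ} (hα : ∀ i, α i ≤ m) {x : ℝ}
    (hx : x < val a α) : ∀ᶠ N in atTop, ∀ β : ℕ → ℕ, (∀ i, β i ≤ m) →
      (∀ i < N, β i = α i) → x < val a β := by
  have ha0 : 0 < a := by linarith
  have h := (summable_val ha hα).hasSum.tendsto_sum_nat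
  filter_upwards [h.eventually (lt_mem_nhds hx)] with N hN β hβ hag
  rw [val_split ha hβ N,
    Finset.sum_congr rfl fun i hi => by rw [hag i (Finset.mem_range.1 hi)]]
  have := div_nonneg (val_nonneg ha (shift N β)) (pow_pos ha0 N).le
  linarith

theorem eventually_val_lt {b : ℝ} (hb : 1 < b) {α : ℕ → ℕ} (hα : ∀ i, α i ≤ m) {x : ℝ}
    (hx : val b α < x) : ∀ᶠ N in atTop, ∀ β : ℕ → ℕ, (∀ i, β i ≤ m) →
      (∀ i < N, β i = α i) → val b β < x := by
  have h : m / (b - 1) - x < val b (reflect m α) := by rw [val_reflect hb hα]; linarith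
  filter_upwards [eventually_lt_val hb (fun i => Nat.sub_le _ _) h] with N hN β hβ hag
  have := hN (reflect m β) (fun i => Nat.sub_le _ _) fun i hi => by
    simp only [reflect, hag i hi]
  rw [val_reflect hb hβ] at this
  linarith

/-- The set of univoque bases has no isolated points. -/
theorem Uset_subset_accPts : Uset m ⊆ accPts (Uset m) := by
  intro q hq
  obtain ⟨h1, hqm, α, hα, hv, hu⟩ := mem_Uset_iff.1 hq
  obtain ⟨hadm, -⟩ := hu.admissible h1 hqm hα hv
  have hm : 0 < m := hadm.zero_pos.trans_le (hα 0)
  have hm' : (0 : ℝ) < m := by exact_mod_cast hm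
  rw [accPts, Set.mem_ofPred_eq, accPt_iff_nhds]
  intro V hV
  obtain ⟨ε, hε, hball⟩ := Metric.mem_nhds_iff.1 hV
  obtain ⟨a, ha, haq⟩ := exists_between (max_lt h1 (sub_lt_self q hε))
  obtain ⟨ha1, haε⟩ := max_lt_iff.1 ha
  have hlow := eventually_lt_val ha1 hα (hv ▸ val_lt_val ha1 haq hα hadm.zero_pos)
  obtain ⟨b, hqb, hbm, hbε, hbev⟩ : ∃ b, q ≤ b ∧ b ≤ m + 1 ∧ b < q + ε ∧
      ∀ᶠ N in atTop, ∀ β : ℕ → ℕ, (∀ i, β i ≤ m) → (∀ i < N, β i = α i) → val b β ≤ 1 := by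
    rcases hqm.lt_or_eq with h | h
    · obtain ⟨b, hb1, hb2⟩ := exists_between (lt_min h (lt_add_of_pos_right q hε))
      obtain ⟨hb2, hb3⟩ := lt_min_iff.1 hb2
      refine ⟨b, hb1.le, hb2.le, hb3, ?_⟩
      filter_upwards [eventually_val_lt (h1.trans hb1) hα
        (hv ▸ val_lt_val h1 hb1 hα hadm.zero_pos)] with N hN β hβ hag
      exact (hN β hβ hag).le
    · refine ⟨q, le_rfl, hqm, by linarith, Eventually.of_forall fun N β hβ _ => ?_⟩
      have := val_le h1 hβ
      rwa [h, add_sub_cancel_right, div_self hm'.ne', ← h] at this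
  obtain ⟨K, hK⟩ := eventually_atTop.1 (hlow.and hbev)
  obtain ⟨N₁, hN₁, hgood₁⟩ := hadm.exists_noReflectedOverlap (max K 2)
  obtain ⟨N₂, hN₂, hgood₂⟩ := hadm.exists_noReflectedOverlap (N₁ + 1)
  obtain ⟨N, hN, hN2, hgood, hne⟩ : ∃ N ≥ K, 2 ≤ N ∧ NoReflectedOverlap m α N ∧
      prefixMirror m α N ≠ α := by
    have hK1 := (le_max_left K 2).trans hN₁
    have h21 := (le_max_right K 2).trans hN₁
    by_cases h : prefixMirror m α N₁ = α
    · exact ⟨N₂, by omega, by omega, hgood₂,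
        prefixMirror_ne hadm hgood₁ (by omega) (by omega) h⟩
    · exact ⟨N₁, by omega, by omega, hgood₁, h⟩
  have hβ := admissible_prefixMirror hadm hgood hN2
  have hva := (hK N hN).1 _ hβ.le fun i hi => prefixMirror_of_lt hi
  have hvb := (hK N hN).2 _ hβ.le fun i hi => prefixMirror_of_lt hi
  obtain ⟨p, ⟨hap, hpb⟩, hp⟩ := intermediate_value_Icc' (haq.le.trans hqb)
    ((continuousOn_val ha1 hβ.le).mono Set.Icc_subset_Ici_self) ⟨hvb, hva.le⟩
  refine ⟨p, ⟨hball ?_, mem_Uset_of_admissible (ha1.trans_le hap) (hpb.trans hbm) hβ hp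
    fun i _ => shift_prefixMirror_lt hadm hgood hN2 i.succ_pos⟩, ?_⟩
  · rw [Metric.mem_ball, Real.dist_eq, abs_lt]
    constructor <;> linarith
  · rintro rfl
    exact hne (hu _ hβ.le (hp.trans hv.symm))

theorem accPts_mono {S T : Set ℝ} (h : S ⊆ T) : accPts S ⊆ accPts T :=
  fun _ hx => hx.mono (principal_mono.2 h)

theorem closure_Uset_subset_accPts : closure (Uset m) ⊆ accPts (closure (Uset m)) := by
  intro q hq
  by_cases h : q ∈ Uset m
  · exact accPts_mono subset_closure (Uset_subset_accPts h)
  · refine accPts_mono subset_closure ?_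
    rw [closure_eq_self_union_derivedSet] at hq
    exact hq.resolve_left h

theorem closure_Uset_subset_B2iter (hm : 0 < m) (i : ℕ) : closure (Uset m) ⊆ B2iter m i := by
  induction i with
  | zero => exact closure_Uset_subset_B2 hm
  | succ i ih => exact closure_Uset_subset_accPts.trans (accPts_mono ih)

end Topology

end UnivoqueBases

/-- `cl(U) ⊆ B_2(m)`, and moreover `cl(U) ⊆ B_2^{(∞)}(m)`. -/
theorem stmt13 (m : ℕ) (hm : 0 < m) :
    closure (Uset m) ⊆ B2 m ∧ closure (Uset m) ⊆ ⋂ i : ℕ, B2iter m i :=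
  ⟨UnivoqueBases.closure_Uset_subset_B2 hm,
    Set.subset_iInter fun i => UnivoqueBases.closure_Uset_subset_B2iter hm i⟩
end

section
/- For every positive integer m, V \ {G(m)} ⊆ B_2(m). -/
/-- `ρ` is a bounded orbit `ρ (i + 1) = q ρ i - c i`, so that `ρ i` is the value of the `i`-th
shift of the digit sequence `c`. -/
def IsRemainder (q : ℝ) (c : ℕ → ℕ) (ρ : ℕ → ℝ) : Prop :=
  (∀ i, ρ (i + 1) = q * ρ i - c i) ∧ ∃ C, ∀ i, |ρ i| ≤ C

lemma IsRemainder.hasSum {q : ℝ} {c : ℕ → ℕ} {ρ : ℕ → ℝ} (hq : 1 < q) (h : IsRemainder q c ρ) :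
    HasSum (fun i => (c i : ℝ) / q ^ (i + 1)) (ρ 0) := by
  obtain ⟨hrec, C, hC⟩ := h
  have hq0 : 0 < q := by linarith
  rw [hasSum_iff_tendsto_nat_of_nonneg (fun i => by positivity)]
  have hpart : ∀ k, ∑ i ∈ Finset.range k, (c i : ℝ) / q ^ (i + 1) = ρ 0 - ρ k * (q⁻¹) ^ k := by
    intro k
    induction k with
    | zero => simp
    | succ k ih =>
      rw [Finset.sum_range_succ, ih, hrec k]
      simp only [inv_pow]
      field_simp
      ring
  simp_rw [hpart]
  have hz : Filter.Tendsto (fun k => ρ k * (q⁻¹) ^ k) Filter.atTop (nhds 0) := by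
    have h1 : Filter.Tendsto (fun k => C * (q⁻¹) ^ k) Filter.atTop (nhds 0) := by
      simpa using (tendsto_pow_atTop_nhds_zero_of_lt_one (by positivity)
        (inv_lt_one_of_one_lt₀ hq)).const_mul C
    refine squeeze_zero_norm (fun k => ?_) h1
    rw [norm_mul, Real.norm_eq_abs, norm_pow, Real.norm_of_nonneg (by positivity : 0 ≤ q⁻¹)]
    exact mul_le_mul_of_nonneg_right (hC k) (by positivity)
  simpa using hz.const_sub (ρ 0)

lemma IsRemainder.expansion {m : ℕ} {q : ℝ} {c : ℕ → ℕ} {ρ : ℕ → ℝ} (hq : 1 < q)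
    (h : IsRemainder q c ρ) (hc : ∀ i, c i ≤ m) : isExpansion m q (ρ 0) c :=
  ⟨hc, (h.hasSum hq).tsum_eq.symm⟩

lemma isRemainder_const {m : ℕ} {q : ℝ} (hq : 1 < q) :
    IsRemainder q (fun _ => m) (fun _ => (m : ℝ) / (q - 1)) := by
  have : q - 1 ≠ 0 := by linarith
  exact ⟨fun _ => by field_simp; ring, _, fun _ => le_rfl⟩

lemma isExpansion.exists_remainder {m : ℕ} {q x : ℝ} {d : ℕ → ℕ} (hq : 1 < q)
    (h : isExpansion m q x d) :
    ∃ R : ℕ → ℝ, IsRemainder q d R ∧ R 0 = x ∧ ∀ i, 0 ≤ R i ∧ R i ≤ (m : ℝ) / (q - 1) := by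
  have hq0 : 0 < q := by linarith
  have hm := (isRemainder_const (m := m) hq).hasSum hq
  have hle : ∀ i j, (d (i + j) : ℝ) / q ^ (j + 1) ≤ (m : ℝ) / q ^ (j + 1) := fun i j => by
    have : (d (i + j) : ℝ) ≤ m := by exact_mod_cast h.1 (i + j)
    gcongr
  have hs : ∀ i, Summable fun j => (d (i + j) : ℝ) / q ^ (j + 1) := fun i =>
    Summable.of_nonneg_of_le (fun j => by positivity) (hle i) hm.summable
  have hb : ∀ i, 0 ≤ ∑' j, (d (i + j) : ℝ) / q ^ (j + 1) ∧
      ∑' j, (d (i + j) : ℝ) / q ^ (j + 1) ≤ (m : ℝ) / (q - 1) := fun i =>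
    ⟨tsum_nonneg fun j => by positivity, by
      rw [← hm.tsum_eq]; exact (hs i).tsum_le_tsum (hle i) hm.summable⟩
  refine ⟨fun i => ∑' j, (d (i + j) : ℝ) / q ^ (j + 1), ⟨fun i => ?_, (m : ℝ) / (q - 1),
    fun i => ?_⟩, by simpa using h.2.symm, hb⟩
  · simp only
    rw [(hs i).tsum_eq_zero_add, mul_add, ← tsum_mul_left]
    have : ∀ j, q * ((d (i + (j + 1)) : ℝ) / q ^ (j + 1 + 1))
        = (d (i + 1 + j) : ℝ) / q ^ (j + 1) := fun j => by
      rw [show i + (j + 1) = i + 1 + j by ring, pow_succ q (j + 1)]; field_simp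
    simp_rw [this]
    field_simp
    simp
  · rw [abs_of_nonneg (hb i).1]; exact (hb i).2

/-- A digit sequence whose remainders satisfy the uniqueness inequalities is a unique expansion. -/
lemma IsRemainder.eq_of_isExpansion {m : ℕ} {q : ℝ} {c d : ℕ → ℕ} {ρ : ℕ → ℝ} (hq : 1 < q)
    (h : IsRemainder q c ρ)
    (hup : ∀ i, c i < m → ρ (i + 1) < 1)
    (hlo : ∀ i, 0 < c i → (m : ℝ) / (q - 1) - 1 < ρ (i + 1))
    (hd : isExpansion m q (ρ 0) d) : d = c := by
  obtain ⟨R, hR, hR0, hRb⟩ := hd.exists_remainder hq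
  have step : ∀ i, R i = ρ i → d i = c i := by
    intro i hi
    have h1 := h.1 i
    have h2 := hR.1 i
    have h3 := hRb (i + 1)
    rcases lt_trichotomy (d i) (c i) with hlt | heq | hgt
    · have h4 := hlo i (by omega)
      have h5 : (d i : ℝ) + 1 ≤ c i := by exact_mod_cast hlt
      rw [hi] at h2
      linarith
    · exact heq
    · have h4 := hup i (hgt.trans_le (hd.1 i))
      have h5 : (c i : ℝ) + 1 ≤ d i := by exact_mod_cast hgt
      rw [hi] at h2
      linarith
  have hall : ∀ i, R i = ρ i := by
    intro i
    induction i with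
    | zero => exact hR0
    | succ i ih => rw [h.1 i, hR.1 i, ih, step i ih]
  exact funext fun i => step i (hall i)

/-- Remainders in the open interval `(0, m/(q-1))` force the expansion to be doubly infinite. -/
lemma IsRemainder.doublyInfinite_of_mem_Ioo {m : ℕ} {q : ℝ} {c : ℕ → ℕ} {ρ : ℕ → ℝ} (hq : 1 < q)
    (h : IsRemainder q c ρ) (hc : ∀ i, c i ≤ m)
    (hρ : ∀ i, 0 < ρ i ∧ ρ i < (m : ℝ) / (q - 1)) : doublyInfinite m c := by
  obtain ⟨hrec, C, hC⟩ := h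
  have tail : ∀ n, IsRemainder q (fun i => c (n + 1 + i)) (fun i => ρ (n + 1 + i)) := fun n =>
    ⟨fun i => hrec (n + 1 + i), C, fun i => hC _⟩
  constructor
  · rintro ⟨n, -, hn⟩
    have h1 := (tail n).hasSum hq
    have h0 : (fun i => ((c (n + 1 + i) : ℕ) : ℝ) / q ^ (i + 1)) = fun _ => 0 := by
      funext i; simp [hn (n + 1 + i) (by omega)]
    rw [h0] at h1
    have := h1.unique hasSum_zero
    have := (hρ (n + 1 + 0)).1
    linarith
  · rintro ⟨n, -, hn⟩
    have h1 := (tail n).hasSum hq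
    have h0 : (fun i => c (n + 1 + i)) = fun _ => m := by
      funext i
      have := hn (n + 1 + i) (by omega)
      have := hc (n + 1 + i)
      simp only at *
      omega
    have h2 := (isRemainder_const (m := m) hq).hasSum hq
    simp only [funext_iff] at h0
    simp only [h0] at h1
    have := h1.unique h2
    have := (hρ (n + 1 + 0)).2
    linarith

/-- Two unique expansions whose values differ by one produce a number with two expansions. -/
lemma mem_B2_of_unique {m : ℕ} (hm : 0 < m) {q x : ℝ} (hq : q ∈ Set.Ioc 1 ((m : ℝ) + 1))
    (hκ : (m : ℝ) / (q - 1) < 2) {a b : ℕ → ℕ}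
    (ha : isExpansion m q (1 + x) a) (hb : isExpansion m q x b)
    (hau : ∀ d, isExpansion m q (1 + x) d → d = a) (hbu : ∀ d, isExpansion m q x d → d = b) :
    q ∈ B2 m := by
  have hq1 := hq.1
  have hq0 : 0 < q := by linarith
  have hq2 : q - 1 ≠ 0 := by linarith
  obtain ⟨A, hA, hA0, -⟩ := ha.exists_remainder hq1
  obtain ⟨B, hB, hB0, hBb⟩ := hb.exists_remainder hq1
  have hx := hBb 0
  rw [hB0] at hx
  have cons : ∀ (j : ℕ) (c : ℕ → ℕ) (y : ℝ), j ≤ m → isExpansion m q y c →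
      isExpansion m q ((j + y) / q) (fun i => Nat.casesOn i j c) := by
    intro j c y hj hc
    obtain ⟨R, ⟨hR, C, hC⟩, hR0, -⟩ := hc.exists_remainder hq1
    refine IsRemainder.expansion (ρ := fun i => Nat.casesOn i ((j + y) / q) R) hq1
      ⟨fun i => ?_, max C |(j + y) / q|, fun i => ?_⟩ (fun i => ?_)
    · cases i with
      | zero =>
        change R 0 = q * ((j + y) / q) - j
        rw [hR0]; field_simp; ring
      | succ i => exact hR i
    · cases i with
      | zero => exact le_max_right _ _
      | succ i => exact (hC i).trans (le_max_left _ _)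
    · cases i with
      | zero => exact hj
      | succ i => exact hc.1 i
  have hm1 : ((m - 1 : ℕ) : ℝ) = m - 1 := by rw [Nat.cast_sub hm]; simp
  refine ⟨hq, (m + x) / q, ⟨by have := hx.1; positivity, ?_⟩,
    (fun i => Nat.casesOn i (m - 1) a), (fun i => Nat.casesOn i m b), ?_, ?_, ?_, ?_⟩
  · rw [div_le_iff₀ hq0]
    have : (m : ℝ) / (q - 1) * q = m + m / (q - 1) := by field_simp; ring
    linarith
  · intro h
    have : m - 1 = m := congrFun h 0
    omega
  · have := cons (m - 1) a (1 + x) (by omega) ha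
    rwa [hm1, show (m : ℝ) - 1 + (1 + x) = m + x by ring] at this
  · exact cons m b x le_rfl hb
  · intro c hc
    obtain ⟨R, hR, hR0, hRb⟩ := hc.exists_remainder hq1
    have h1 := hR.1 0
    have h2 : q * R 0 = m + x := by rw [hR0]; field_simp
    have tail : isExpansion m q (R 1) (fun i => c (i + 1)) :=
      IsRemainder.expansion (ρ := fun i => R (i + 1)) hq1
        ⟨fun i => hR.1 (i + 1), hR.2.imp fun C hC i => hC _⟩ (fun i => hc.1 _)
    rw [h2, zero_add] at h1
    have hc0 := hc.1 0
    rcases (by omega : c 0 = m ∨ c 0 = m - 1 ∨ c 0 + 2 ≤ m) with h | h | h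
    · right
      rw [h, show (m : ℝ) + x - m = x by ring] at h1
      rw [h1] at tail
      have := hbu _ tail
      funext i
      cases i with
      | zero => exact h
      | succ i => exact congrFun this i
    · left
      rw [h, hm1, show (m : ℝ) + x - (m - 1) = 1 + x by ring] at h1
      rw [h1] at tail
      have := hau _ tail
      funext i
      cases i with
      | zero => exact h
      | succ i => exact congrFun this i
    · exfalso
      have h3 : (c 0 : ℝ) + 2 ≤ m := by exact_mod_cast h
      have := (hRb 1).2
      linarith [hx.1]

/-- The orbit `z` of `1` under the quasi-greedy map with digits `α`, confined to `[κ - 1, 1]`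
where `κ = m / (q - 1)`. -/
structure QuasiOrbit (m : ℕ) (q κ : ℝ) (z : ℕ → ℝ) (α : ℕ → ℕ) : Prop where
  one_lt : 1 < q
  lt_succ : q < m + 1
  kappa_mul : κ * (q - 1) = m
  zero : z 0 = 1
  step : ∀ i, z (i + 1) = q * z i - α i
  pos : ∀ i, 0 < z i
  le_one : ∀ i, z i ≤ 1
  ge : ∀ i, κ - 1 ≤ z i

namespace QuasiOrbit

variable {m : ℕ} {q κ : ℝ} {z : ℕ → ℝ} {α : ℕ → ℕ}

lemma one_lt_kappa (h : QuasiOrbit m q κ z α) : 1 < κ := by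
  have h1 := h.one_lt
  have h2 := h.lt_succ
  have h3 := h.kappa_mul
  by_contra! hc
  nlinarith

lemma mul_pow_one_sub (h : QuasiOrbit m q κ z α) (s t : ℕ) :
    q ^ t * (1 - z s) = z t - z (s + t) ∨ z t ≤ q ^ t * (1 - z s) := by
  have hq := h.one_lt
  induction t with
  | zero => left; simp [h.zero]
  | succ t ih =>
    have e1 := h.step t
    have e2 := h.step (s + t)
    rw [show s + (t + 1) = s + t + 1 by ring, pow_succ', mul_assoc]
    rcases ih with ih | ih
    · have hnn : 0 ≤ q * (q ^ t * (1 - z s)) := by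
        have := h.le_one s
        exact mul_nonneg (by linarith) (mul_nonneg (by positivity) (by linarith))
      rw [ih] at hnn ⊢
      have b1 := h.le_one (t + 1)
      have b2 := h.le_one (s + t + 1)
      have b3 := h.pos (s + t + 1)
      rcases lt_trichotomy (α t) (α (s + t)) with hlt | heq | hgt
      · have : (α t : ℝ) + 1 ≤ α (s + t) := by exact_mod_cast hlt
        linarith
      · left
        rw [e1, e2, heq]; ring
      · right
        have : (α (s + t) : ℝ) + 1 ≤ α t := by exact_mod_cast hgt
        linarith
    · right
      have : q * z t ≤ q * (q ^ t * (1 - z s)) := mul_le_mul_of_nonneg_left ih (by linarith)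
      have := (α t).cast_nonneg (α := ℝ)
      linarith

lemma sub_le_mul_pow_one_sub (h : QuasiOrbit m q κ z α) (s t : ℕ) :
    z t - z (s + t) ≤ q ^ t * (1 - z s) := by
  have := h.pos (s + t)
  rcases h.mul_pow_one_sub s t with h1 | h1 <;> linarith

lemma le_mul_pow_one_sub (h : QuasiOrbit m q κ z α) {s t : ℕ} (hs : z s < 1)
    (hst : z (s + t) = 1) : z t ≤ q ^ t * (1 - z s) := by
  rcases h.mul_pow_one_sub s t with h1 | h1
  · have : 0 < q ^ t * (1 - z s) :=
      mul_pos (pow_pos (by linarith [h.one_lt]) _) (by linarith)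
    have := h.le_one t
    linarith
  · exact h1

lemma le_pow_mul (h : QuasiOrbit m q κ z α) (s t : ℕ) : z (s + t) ≤ q ^ t * z s := by
  induction t with
  | zero => simp
  | succ t ih =>
    have e := h.step (s + t)
    have := mul_le_mul_of_nonneg_left ih (by linarith [h.one_lt] : (0 : ℝ) ≤ q)
    have := (α (s + t)).cast_nonneg (α := ℝ)
    rw [show s + (t + 1) = s + t + 1 by ring, pow_succ', mul_assoc]
    linarith

/-- The expansion of `κ - z i` is strictly below that of `1` already within the first `k`
digits. -/
def Detects (q κ : ℝ) (z : ℕ → ℝ) (i k : ℕ) : Prop :=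
  1 ≤ k ∧ z k + z (i + k) - (κ - 1) ≤ q ^ k * (z i - (κ - 1))

lemma eq_or_detects (h : QuasiOrbit m q κ z α) (i t : ℕ) :
    q ^ t * (z i - (κ - 1)) = z t + z (i + t) - κ ∨ ∃ k ≤ t, Detects q κ z i k := by
  have hq := h.one_lt
  have hκ := h.one_lt_kappa
  induction t with
  | zero => left; simp [h.zero]; ring
  | succ t ih =>
    rcases ih with ih | ⟨k, hk, hd⟩
    · have e1 := h.step t
      have e2 := h.step (i + t)
      have e3 := h.kappa_mul
      have key : q ^ (t + 1) * (z i - (κ - 1)) =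
          z (t + 1) + z (i + t + 1) - κ + (α t + α (i + t) - m) := by
        rw [pow_succ', mul_assoc, ih]
        linear_combination -e1 - e2 - e3
      have hnn : 0 ≤ q ^ (t + 1) * (z i - (κ - 1)) := by
        have := h.ge i
        exact mul_nonneg (by positivity) (by linarith)
      have b1 := h.le_one (t + 1)
      have b2 := h.le_one (i + t + 1)
      rcases lt_trichotomy (α t + α (i + t)) m with hlt | heq | hgt
      · have : (α t : ℝ) + α (i + t) + 1 ≤ m := by exact_mod_cast hlt
        linarith
      · left
        have : (α t : ℝ) + α (i + t) = m := by exact_mod_cast heq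
        rw [key, this]; ring_nf
      · right
        refine ⟨t + 1, le_rfl, by omega, ?_⟩
        have : (m : ℝ) + 1 ≤ α t + α (i + t) := by exact_mod_cast hgt
        rw [key, show i + (t + 1) = i + t + 1 by ring]
        linarith
    · exact Or.inr ⟨k, by omega, hd⟩

lemma exists_detects (h : QuasiOrbit m q κ z α) {i : ℕ} (hi : κ - 1 < z i) :
    ∃ k, Detects q κ z i k := by
  by_contra! hc
  obtain ⟨t, ht⟩ := pow_unbounded_of_one_lt (2 / (z i - (κ - 1))) h.one_lt
  rw [div_lt_iff₀ (by linarith)] at ht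
  rcases h.eq_or_detects i t with h1 | ⟨k, -, hk⟩
  · have := h.one_lt_kappa
    have := h.le_one t
    have := h.le_one (i + t)
    linarith
  · exact hc k hk

lemma shift_of_eq_one (h : QuasiOrbit m q κ z α) {r : ℕ} (hr : z r = 1) (s : ℕ) :
    z (r + s) = z s := by
  induction s with
  | zero => simp [hr, h.zero]
  | succ s ih =>
    have e1 := h.step (r + s)
    have e2 := h.step s
    rw [ih] at e1
    have b1 := h.le_one (r + s + 1)
    have b2 := h.le_one (s + 1)
    have b3 := h.pos (r + s + 1)
    have b4 := h.pos (s + 1)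
    have h1 : ((α s : ℤ) : ℝ) < ((α (r + s) + 1 : ℤ) : ℝ) := by push_cast; linarith
    have h2 : ((α (r + s) : ℤ) : ℝ) < ((α s + 1 : ℤ) : ℝ) := by push_cast; linarith
    rw [Int.cast_lt] at h1 h2
    have : α s = α (r + s) := by omega
    rw [show r + (s + 1) = r + s + 1 by ring, e1, e2, this]

lemma shift_of_eq_kappa_sub_one (h : QuasiOrbit m q κ z α) {r : ℕ} (hr : z r = κ - 1) (s : ℕ) :
    z (r + s) = κ - z s := by
  have hκ := h.kappa_mul
  have hκ1 := h.one_lt_kappa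
  induction s with
  | zero => simp [hr, h.zero]
  | succ s ih =>
    have e1 := h.step (r + s)
    have e2 := h.step s
    rw [ih] at e1
    have b1 := h.le_one (r + s + 1)
    have b2 := h.le_one (s + 1)
    have b3 := h.pos (r + s + 1)
    have b4 := h.ge (s + 1)
    have h1 : ((α s + α (r + s) : ℤ) : ℝ) < ((m + 1 : ℤ) : ℝ) := by push_cast; linarith
    have h2 : ((m : ℤ) : ℝ) < ((α s + α (r + s) + 1 : ℤ) : ℝ) := by push_cast; linarith
    rw [Int.cast_lt] at h1 h2
    have : (α s : ℝ) + α (r + s) = m := by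
      have : α s + α (r + s) = m := by omega
      exact_mod_cast this
    rw [show r + (s + 1) = r + s + 1 by ring, e1, e2]
    linarith

/-- If every index below `N` is detected within `N` digits, then cutting the orbit at `N` stays
inside the uniqueness window. -/
lemma pow_mul_ge_of_detects (h : QuasiOrbit m q κ z α) {N : ℕ}
    (hN : ∀ i, 0 < i → i < N → ∃ k ≤ N - i, Detects q κ z i k) (t : ℕ) :
    0 < t → t < N → z t + z N - (κ - 1) ≤ q ^ t * (z (N - t) - (κ - 1)) := by
  have hq := h.one_lt
  induction t using Nat.strong_induction_on with
  | _ t ih =>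
    intro h0 hlt
    obtain ⟨k, hk, hk1, hd⟩ := hN (N - t) (by omega) (by omega)
    have hkt : k ≤ t := by omega
    have hmul := mul_le_mul_of_nonneg_left hd (by positivity : 0 ≤ q ^ (t - k))
    rw [← mul_assoc, ← pow_add, Nat.sub_add_cancel hkt] at hmul
    refine le_trans ?_ hmul
    have h1 := h.le_pow_mul k (t - k)
    rw [Nat.add_sub_cancel' hkt] at h1
    have h2 : z N - (κ - 1) ≤ q ^ (t - k) * (z (N - t + k) - (κ - 1)) := by
      rcases hkt.eq_or_lt with rfl | hlt'
      · simp [Nat.sub_add_cancel hlt.le]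
      · have := ih (t - k) (by omega) (by omega) (by omega)
        rw [show N - (t - k) = N - t + k by omega] at this
        linarith [h.pos (t - k)]
    linarith

lemma mul_lt_of_cross_bounds {a b w P Q : ℝ} (hP : 1 < P) (hw : 0 < w)
    (h1 : b + w ≤ Q * a) (h2 : a + w ≤ P * b) : P * w < a * (P * Q - 1) := by
  nlinarith

lemma cut_of_detects (h : QuasiOrbit m q κ z α) {N : ℕ}
    (hN : ∀ i, 0 < i → i < N → ∃ k ≤ N - i, Detects q κ z i k) {i : ℕ} (hi : 0 < i)
    (hiN : i < N) : q ^ i * z N < (z i - (κ - 1)) * (q ^ N - 1) := by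
  have hq := h.one_lt
  have h1 := h.pow_mul_ge_of_detects hN (N - i) (by omega) (by omega)
  have h2 := h.pow_mul_ge_of_detects hN i hi hiN
  rw [Nat.sub_sub_self hiN.le] at h1
  have := mul_lt_of_cross_bounds (one_lt_pow₀ hq hi.ne') (h.pos N)
    (Q := q ^ (N - i)) (a := z i - (κ - 1)) (b := z (N - i) - (κ - 1)) (by linarith) (by linarith)
  rwa [← pow_add, Nat.add_sub_cancel' hiN.le] at this

lemma exists_detected_ge (h : QuasiOrbit m q κ z α) (hu : ∀ i, 0 < i → κ - 1 < z i) (M : ℕ) :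
    ∃ N, M ≤ N ∧ ∀ i, 0 < i → i < N → ∃ k ≤ N - i, Detects q κ z i k := by
  classical
  by_cases hM : ∀ i, 0 < i → i < M → ∃ k ≤ M - i, Detects q κ z i k
  · exact ⟨M, le_rfl, hM⟩
  push Not at hM
  have hspec := Nat.find_spec hM
  have hmin : ∀ i, i < Nat.find hM → 0 < i → i < M → ∃ k ≤ M - i, Detects q κ z i k := by
    intro i hi h0 h1
    have := Nat.find_min hM hi
    push Not at this
    exact this h0 h1
  generalize Nat.find hM = j at hspec hmin
  obtain ⟨hj0, hjM, hj⟩ := hspec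
  have hex := h.exists_detects (hu j hj0)
  have hl := Nat.find_spec hex
  have hlmin : ∀ k, k < Nat.find hex → ¬ Detects q κ z j k := fun k hk => Nat.find_min hex hk
  generalize Nat.find hex = l at hl hlmin
  have hlM : M < j + l := by
    by_contra! hc
    exact hj l (by omega) hl
  refine ⟨j + l, hlM.le, fun i h0 hi => ?_⟩
  rcases lt_trichotomy i j with hij | rfl | hij
  · obtain ⟨k, hk, hd⟩ := hmin i hij h0 (by omega)
    exact ⟨k, by omega, hd⟩
  · exact ⟨l, by omega, hl⟩
  · obtain ⟨s, rfl⟩ := Nat.exists_eq_add_of_le hij.le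
    refine ⟨l - s, by omega, by omega, ?_⟩
    have e : q ^ s * (z j - (κ - 1)) = z s + z (j + s) - κ := by
      rcases h.eq_or_detects j s with h1 | ⟨k, hk, hd⟩
      · exact h1
      · exact absurd hd (hlmin k (by omega))
    have h1 := h.sub_le_mul_pow_one_sub s (l - s)
    rw [show s + (l - s) = l by omega] at h1
    have h2 := hl.2
    rw [show l = l - s + s by omega, pow_add, mul_assoc, e, show l - s + s = l by omega] at h2
    rw [show j + s + (l - s) = j + l by omega]
    linarith

lemma digit_lt (h : QuasiOrbit m q κ z α) (i : ℕ) : (α i : ℝ) < q := by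
  have := h.step i
  have := h.pos (i + 1)
  nlinarith [h.le_one i, h.one_lt]

lemma digit_le (h : QuasiOrbit m q κ z α) (i : ℕ) : α i ≤ m := by
  have : ((α i : ℕ) : ℝ) < ((m + 1 : ℕ) : ℝ) := by
    push_cast; exact (h.digit_lt i).trans h.lt_succ
  rw [Nat.cast_lt] at this
  omega

lemma mul_two_sub (h : QuasiOrbit m q κ z α) :
    q * (2 - κ) = 2 * z 1 - κ + (2 * α 0 - m) := by
  have e := h.step 0
  rw [h.zero, zero_add] at e
  linear_combination (-2) * e - h.kappa_mul

lemma cut_zero (h : QuasiOrbit m q κ z α) (hα : m + 1 ≤ 2 * α 0) {N : ℕ} (hN : 1 < N)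
    (hd : ∀ i, 0 < i → i < N → ∃ k ≤ N - i, Detects q κ z i k) :
    z N < (2 - κ) * (q ^ N - 1) := by
  have hq := h.one_lt
  have h1 := h.cut_of_detects hd one_pos hN
  have h2 := h.mul_two_sub
  have h3 : (m : ℝ) + 1 ≤ 2 * α 0 := by exact_mod_cast hα
  have h4 : 0 < q ^ N - 1 := by linarith [one_lt_pow₀ hq (by omega : N ≠ 0)]
  have h5 : z 1 - (κ - 1) ≤ q * (2 - κ) := by linarith [h.pos 1]
  have h6 := mul_le_mul_of_nonneg_right h5 h4.le
  rw [pow_one] at h1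
  have h7 : q * z N < q * ((2 - κ) * (q ^ N - 1)) := by linarith
  exact lt_of_mul_lt_mul_left h7 (by linarith)

/-- The value `z N / (q ^ N - 1)` is how far the periodic sequence `(α₁ … α_N⁻)^∞` lies below
`1`; the cut condition places the reflected periodic sequence in the uniqueness window. -/
def IsCut (q κ : ℝ) (z : ℕ → ℝ) (N : ℕ) : Prop :=
  0 < N ∧ ∀ i < N, q ^ i * (z N / (q ^ N - 1)) < z i - (κ - 1)

lemma isCut_iff (h : QuasiOrbit m q κ z α) {N : ℕ} (hN : 0 < N) :
    IsCut q κ z N ↔ ∀ i < N, q ^ i * z N < (z i - (κ - 1)) * (q ^ N - 1) := by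
  have h4 : 0 < q ^ N - 1 := by linarith [one_lt_pow₀ h.one_lt hN.ne']
  simp only [IsCut, hN, true_and, ← mul_div_assoc, div_lt_iff₀ h4]

lemma isCut_of_detects (h : QuasiOrbit m q κ z α) (hα : m + 1 ≤ 2 * α 0) {N : ℕ} (hN : 1 < N)
    (hd : ∀ i, 0 < i → i < N → ∃ k ≤ N - i, Detects q κ z i k) : IsCut q κ z N := by
  rw [h.isCut_iff (by omega)]
  intro i hi
  rcases Nat.eq_zero_or_pos i with rfl | h0
  · have := h.cut_zero hα hN hd
    rw [h.zero]
    linarith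
  · exact h.cut_of_detects hd h0 hi

lemma IsCut.excess_pos (h : QuasiOrbit m q κ z α) {N : ℕ} (hN : 0 < N) :
    0 < z N / (q ^ N - 1) :=
  div_pos (h.pos N) (by linarith [one_lt_pow₀ h.one_lt hN.ne'])

lemma IsCut.lt (h : QuasiOrbit m q κ z α) {N : ℕ} (hN : IsCut q κ z N) {i : ℕ} (hi : i < N) :
    κ - 1 + z N / (q ^ N - 1) < z i := by
  have h1 := hN.2 i hi
  have h2 := IsCut.excess_pos h hN.1
  have h3 : (1 : ℝ) ≤ q ^ i := one_le_pow₀ h.one_lt.le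
  nlinarith

lemma exists_cut_of_forall_gt (h : QuasiOrbit m q κ z α) (hα : m + 1 ≤ 2 * α 0)
    (hu : ∀ i, 0 < i → κ - 1 < z i) (hper : ∃ n, 0 < n ∧ z n = 1) :
    ∃ n N, 0 < n ∧ z n = 1 ∧ IsCut q κ z N ∧
      ∀ i, 0 < i → i < n → κ - 1 + z N / (q ^ N - 1) < q ^ (n - i) * (1 - z i) := by
  classical
  obtain ⟨hn0, hn⟩ := Nat.find_spec hper
  have hmin : ∀ i, i < Nat.find hper → 0 < i → z i < 1 := fun i hi h0 =>
    lt_of_le_of_ne (h.le_one i) fun he => Nat.find_min hper hi ⟨h0, he⟩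
  generalize Nat.find hper = n at hn0 hn hmin
  obtain ⟨N, hN, hd⟩ := h.exists_detected_ge hu (n + 1)
  have hcut := h.isCut_of_detects hα (by omega) hd
  refine ⟨n, N, hn0, hn, hcut, fun i h0 hi => ?_⟩
  have h1 := h.le_mul_pow_one_sub (s := i) (t := n - i) (hmin i hi h0)
    (by rw [Nat.add_sub_cancel' hi.le]; exact hn)
  exact (hcut.lt h (by omega)).trans_le h1

lemma exists_cut_of_eq (h : QuasiOrbit m q κ z α) (hκ : κ < 2) (hα : m + 1 ≤ 2 * α 0)
    (hα' : z 1 = κ - 1 → m + 2 ≤ 2 * α 0) (hper : ∃ r, 0 < r ∧ z r = κ - 1) :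
    ∃ n N, 0 < n ∧ z n = 1 ∧ IsCut q κ z N ∧
      ∀ i, 0 < i → i < n → κ - 1 + z N / (q ^ N - 1) < q ^ (n - i) * (1 - z i) := by
  classical
  have hq := h.one_lt
  obtain ⟨hr0, hr⟩ := Nat.find_spec hper
  have hmin : ∀ i, i < Nat.find hper → 0 < i → κ - 1 < z i := fun i hi h0 =>
    lt_of_le_of_ne (h.ge i) fun he => Nat.find_min hper hi ⟨h0, he.symm⟩
  generalize Nat.find hper = r at hr0 hr hmin
  have hcut : IsCut q κ z r := by
    rcases (by omega : r = 1 ∨ 1 < r) with rfl | hr1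
    · rw [h.isCut_iff one_pos]
      intro i hi
      obtain rfl : i = 0 := by omega
      have h1 := h.mul_two_sub
      have h2 : (m : ℝ) + 2 ≤ 2 * α 0 := by exact_mod_cast hα' hr
      rw [hr] at h1
      rw [h.zero, hr, pow_one, pow_zero]
      linarith [h.one_lt_kappa]
    · refine h.isCut_of_detects hα hr1 fun i h0 hi => ?_
      rcases h.eq_or_detects i (r - i) with h1 | h1
      · have h2 : 0 < q ^ (r - i) * (z i - (κ - 1)) :=
          mul_pos (by positivity) (by linarith [hmin i hi h0])
        rw [Nat.add_sub_cancel' hi.le, hr] at h1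
        linarith [h.le_one (r - i)]
      · exact h1
  have hc := (h.isCut_iff hr0).1 hcut
  have hlt : ∀ i, 0 < i → i < r → z i < 1 := fun i h0 hi =>
    lt_of_le_of_ne (h.le_one i) fun he => by
      have h1 := h.shift_of_eq_one he (r - i)
      rw [Nat.add_sub_cancel' hi.le, hr] at h1
      linarith [hmin (r - i) (by omega) (by omega)]
  have hz2 : z (r + r) = 1 := by rw [h.shift_of_eq_kappa_sub_one hr, hr]; ring
  refine ⟨r + r, r, by omega, hz2, hcut, fun i h0 hi => ?_⟩
  rcases lt_trichotomy i r with hir | rfl | hir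
  · have h1 := h.sub_le_mul_pow_one_sub i (r - i)
    rw [Nat.add_sub_cancel' hir.le, hr] at h1
    have h2 := mul_le_mul_of_nonneg_left h1 (by positivity : 0 ≤ q ^ r)
    rw [← mul_assoc, ← pow_add, show r + (r - i) = r + r - i by omega] at h2
    have h3 := hc (r - i) (by omega)
    have h4 := hcut.2 (r - i) (by omega)
    have h5 : (1 : ℝ) ≤ q ^ (r - i) := one_le_pow₀ hq.le
    have h6 := h.pos r
    have h7 := IsCut.excess_pos h hr0
    rw [hr] at *
    nlinarith
  · have h1 := hc 0 hr0
    have h2 := hcut.lt h hr0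
    rw [h.zero] at h1 h2
    rw [Nat.add_sub_cancel]
    rw [hr] at *
    nlinarith
  · obtain ⟨s, rfl⟩ := Nat.exists_eq_add_of_le hir.le
    have h1 : z (r + s) < 1 := by
      rw [h.shift_of_eq_kappa_sub_one hr]
      linarith [hmin s (by omega) (by omega)]
    have h2 := h.le_mul_pow_one_sub (s := r + s) (t := r + r - (r + s)) h1
      (by rw [show r + s + (r + r - (r + s)) = r + r by omega]; exact hz2)
    exact (hcut.lt h (by omega)).trans_le h2

/-- The reflected periodic sequence attached to a cut. -/
lemma exists_reflected_periodic (h : QuasiOrbit m q κ z α) {N : ℕ} (hN : IsCut q κ z N) :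
    ∃ (γ : ℕ → ℕ) (G : ℕ → ℝ), IsRemainder q γ G ∧ (∀ i, γ i ≤ m) ∧
      (∀ i, κ - 1 < G i ∧ G i < 1) ∧ G 0 = κ - 1 + z N / (q ^ N - 1) := by
  have hq := h.one_lt
  have hκ := h.kappa_mul
  have hκ1 := h.one_lt_kappa
  obtain ⟨hN0, hc⟩ := hN
  have hε := IsCut.excess_pos h hN0
  have hεq : q ^ N * (z N / (q ^ N - 1)) = z N / (q ^ N - 1) + z N := by
    have : q ^ N - 1 ≠ 0 := by linarith [one_lt_pow₀ hq hN0.ne']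
    field_simp; ring
  generalize z N / (q ^ N - 1) = ε at hc hε hεq
  have hb : ∀ i, κ - 1 < κ - z (i % N) + q ^ (i % N) * ε ∧
      κ - z (i % N) + q ^ (i % N) * ε < 1 := fun i => by
    have h1 := hc _ (Nat.mod_lt i hN0)
    have h2 := h.le_one (i % N)
    have h3 : 0 < q ^ (i % N) * ε := by positivity
    constructor <;> linarith
  have hmod : ∀ i, (i % N + 1 < N ∧ (i + 1) % N = i % N + 1) ∨
      (i % N + 1 = N ∧ (i + 1) % N = 0) := fun i => by
    have h1 := Nat.mod_lt i hN0
    have h2 : (i + 1) % N = (i % N + 1) % N := by simp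
    rcases (by omega : i % N + 1 < N ∨ i % N + 1 = N) with h3 | h3
    · exact Or.inl ⟨h3, by rw [h2, Nat.mod_eq_of_lt h3]⟩
    · exact Or.inr ⟨h3, by rw [h2, h3, Nat.mod_self]⟩
  have hstep : ∀ i, κ - z ((i + 1) % N) + q ^ ((i + 1) % N) * ε =
      q * (κ - z (i % N) + q ^ (i % N) * ε) -
        (m - α (i % N) + if i % N + 1 = N then 1 else 0) := fun i => by
    have e := h.step (i % N)
    rcases hmod i with ⟨h1, h2⟩ | ⟨h1, h2⟩
    · rw [h2, if_neg h1.ne, pow_succ]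
      linear_combination -e - hκ
    · have h3 : q ^ N = q ^ (i % N) * q := by rw [← pow_succ, h1]
      rw [h2, if_pos h1, h.zero]
      rw [h1] at e
      rw [h3] at hεq
      linear_combination -e - hκ - hεq
  refine ⟨fun i => m - α (i % N) + if i % N + 1 = N then 1 else 0,
    fun i => κ - z (i % N) + q ^ (i % N) * ε, ⟨fun i => ?_, 1, fun i => ?_⟩, fun i => ?_, hb, ?_⟩
  · simp only
    rw [hstep i]
    push_cast [h.digit_le (i % N)]
    rfl
  · have := hb i
    rw [abs_of_nonneg (by linarith)]
    linarith
  · have hle := h.digit_le (i % N)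
    simp only
    split_ifs with h1
    · have : α (i % N) ≠ 0 := fun h0 => by
        have h2 := hstep i
        have h3 := hb i
        have h4 := hb (i + 1)
        rw [if_pos h1, h0] at h2
        push_cast at h2
        have h5 := h.lt_succ
        nlinarith
      omega
    · omega
  · simp [Nat.zero_mod, h.zero]

lemma kappa_eq (h : QuasiOrbit m q κ z α) : (m : ℝ) / (q - 1) = κ := by
  rw [div_eq_iff (by linarith [h.one_lt])]; exact h.kappa_mul.symm

lemma mem_Ioc (h : QuasiOrbit m q κ z α) : q ∈ Set.Ioc 1 ((m : ℝ) + 1) :=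
  ⟨h.one_lt, h.lt_succ.le⟩

lemma isRemainder (h : QuasiOrbit m q κ z α) : IsRemainder q α z :=
  ⟨h.step, 1, fun i => by rw [abs_of_pos (h.pos i)]; exact h.le_one i⟩

lemma mem_B2_of_lt (h : QuasiOrbit m q κ z α) (hm : 0 < m) (hκ : κ < 2)
    (hz : ∀ i, 0 < i → κ - 1 < z i ∧ z i < 1) : q ∈ B2 m := by
  have hq := h.one_lt
  have h0 : IsRemainder q (fun _ => 0) (fun _ => 0) := ⟨fun _ => by simp, 0, fun _ => by simp⟩
  refine mem_B2_of_unique hm h.mem_Ioc (by rwa [h.kappa_eq]) (x := 0) (a := α) (b := fun _ => 0)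
    ?_ (h0.expansion hq fun _ => Nat.zero_le _) (fun d hd => ?_) (fun d hd => ?_)
  · have := h.isRemainder.expansion hq h.digit_le
    rwa [h.zero, ← add_zero (1 : ℝ)] at this
  · refine h.isRemainder.eq_of_isExpansion hq (m := m) (fun i _ => (hz _ i.succ_pos).2)
      (fun i _ => ?_) (by rwa [h.zero, ← add_zero (1 : ℝ)])
    rw [h.kappa_eq]; exact (hz _ i.succ_pos).1
  · exact h0.eq_of_isExpansion hq (fun _ _ => one_pos) (fun i hi => absurd hi (lt_irrefl _)) hd

lemma mem_B2_of_cut (h : QuasiOrbit m q κ z α) (hm : 0 < m) (hκ : κ < 2) {n N : ℕ} (hn : 0 < n)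
    (hzn : z n = 1) (hN : IsCut q κ z N)
    (hlt : ∀ i, 0 < i → i < n → κ - 1 + z N / (q ^ N - 1) < q ^ (n - i) * (1 - z i)) :
    q ∈ B2 m := by
  have hq := h.one_lt
  have hκ1 := h.one_lt_kappa
  obtain ⟨γ, G, ⟨hG, -⟩, hγm, hGb, hG0⟩ := h.exists_reflected_periodic hN
  rw [← hG0] at hlt
  have hg := hGb 0
  have hg0 : 0 < G 0 := by linarith
  have hqn : 0 < q ^ n := by positivity
  obtain ⟨x, hqx⟩ : ∃ x, q ^ n * x = G 0 := ⟨G 0 / q ^ n, by field_simp⟩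
  have hx0 : 0 < x := pos_of_mul_pos_right (hqx ▸ hg0) hqn.le
  have hqi : ∀ i ≤ n, q ^ i * x ≤ q ^ n * x := fun i hi =>
    mul_le_mul_of_nonneg_right (pow_le_pow_right₀ hq.le hi) hx0.le
  set A : ℕ → ℝ := fun i => if i < n then z i + q ^ i * x else G (i - n) with hA
  set B : ℕ → ℝ := fun i => if i < n then q ^ i * x else G (i - n) with hB
  set a : ℕ → ℕ := fun i => if i < n then (if i + 1 = n then α i + 1 else α i) else γ (i - n)
    with ha
  set b : ℕ → ℕ := fun i => if i < n then 0 else γ (i - n) with hb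
  have hA0 : A 0 = 1 + x := by simp [hA, hn, h.zero]
  have hB0 : B 0 = x := by simp [hB, hn]
  have hAr : IsRemainder q a A := by
    refine ⟨fun i => ?_, 2, fun i => ?_⟩
    · have e := h.step i
      rcases lt_trichotomy (i + 1) n with hi | hi | hi
      · have hi' : i < n := by omega
        simp only [hA, ha, if_pos hi, if_pos hi', if_neg hi.ne, e, pow_succ]
        ring
      · have hi' : i < n := by omega
        simp only [hA, ha, lt_irrefl, if_false, if_true, if_pos hi', hi, Nat.sub_self]
        rw [hi, hzn] at e
        rw [← hi, pow_succ] at hqx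
        push_cast
        linear_combination e - hqx
      · have hi' : ¬ i < n := by omega
        have hi'' : ¬ i + 1 < n := by omega
        simp only [hA, ha, if_neg hi', if_neg hi'', show i + 1 - n = i - n + 1 by omega, hG]
    · simp only [hA]
      split_ifs with hi
      · have h1 := hqi i hi.le
        have h2 : 0 ≤ q ^ i * x := by positivity
        rw [abs_of_nonneg (by linarith [h.pos i])]
        linarith [h.le_one i]
      · have := hGb (i - n)
        rw [abs_of_nonneg (by linarith)]
        linarith
  have hBr : IsRemainder q b B := by
    refine ⟨fun i => ?_, 2, fun i => ?_⟩
    · rcases lt_trichotomy (i + 1) n with hi | hi | hi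
      · have hi' : i < n := by omega
        simp only [hB, hb, if_pos hi, if_pos hi', pow_succ]
        push_cast
        ring
      · have hi' : i < n := by omega
        simp only [hB, hb, lt_irrefl, if_false, if_pos hi', hi, Nat.sub_self]
        rw [← hi, pow_succ] at hqx
        push_cast
        linear_combination -hqx
      · have hi' : ¬ i < n := by omega
        have hi'' : ¬ i + 1 < n := by omega
        simp only [hB, hb, if_neg hi', if_neg hi'', show i + 1 - n = i - n + 1 by omega, hG]
    · simp only [hB]
      split_ifs with hi
      · have h1 := hqi i hi.le
        rw [abs_of_nonneg (by positivity)]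
        linarith
      · have := hGb (i - n)
        rw [abs_of_nonneg (by linarith)]
        linarith
  have ham : ∀ i, a i ≤ m := fun i => by
    simp only [ha]
    split_ifs with h1 h2
    · have e := h.step i
      rw [h2, hzn] at e
      have h3 : ((α i + 1 : ℕ) : ℝ) < ((m + 1 : ℕ) : ℝ) := by
        push_cast
        nlinarith [h.le_one i, h.lt_succ]
      rw [Nat.cast_lt] at h3
      omega
    · exact h.digit_le i
    · exact hγm _
  have hbm : ∀ i, b i ≤ m := fun i => by
    simp only [hb]
    split_ifs with h1
    · exact Nat.zero_le _
    · exact hγm _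
  have hAup : ∀ i, A (i + 1) < 1 := fun i => by
    simp only [hA]
    split_ifs with h1
    · have h2 := hlt (i + 1) i.succ_pos h1
      have h3 : q ^ n = q ^ (n - (i + 1)) * q ^ (i + 1) := by
        rw [← pow_add, Nat.sub_add_cancel h1.le]
      rw [← hqx, h3, mul_assoc] at h2
      have := lt_of_mul_lt_mul_left h2 (by positivity)
      linarith
    · exact (hGb _).2
  have hAlo : ∀ i, κ - 1 < A i := fun i => by
    simp only [hA]
    split_ifs with h1
    · have : 0 < q ^ i * x := by positivity
      linarith [h.ge i]
    · exact (hGb _).1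
  have hBup : ∀ i, B i < 1 := fun i => by
    simp only [hB]
    split_ifs with h1
    · linarith [hqi i h1.le]
    · exact (hGb _).2
  refine mem_B2_of_unique hm h.mem_Ioc (by rwa [h.kappa_eq]) (x := x) (a := a) (b := b)
    (hA0 ▸ hAr.expansion hq ham) (hB0 ▸ hBr.expansion hq hbm) (fun d hd => ?_) (fun d hd => ?_)
  · rw [← hA0] at hd
    refine hAr.eq_of_isExpansion hq (fun i _ => hAup i) (fun i _ => ?_) hd
    rw [h.kappa_eq]; exact hAlo _
  · rw [← hB0] at hd
    refine hBr.eq_of_isExpansion hq (fun i _ => hBup _) (fun i hi => ?_) hd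
    rw [h.kappa_eq]
    simp only [hb] at hi
    split_ifs at hi with h1
    · simp at hi
    · simp only [hB, if_neg (by omega : ¬ i + 1 < n)]
      exact (hGb _).1

end QuasiOrbit

/-- The quasi-greedy digit `min m (⌈q x⌉ - 1)`. -/
noncomputable def quasiDigit (m : ℕ) (q x : ℝ) : ℕ := min m (⌈q * x⌉₊ - 1)

/-- The remainders of the quasi-greedy expansion of `x`. -/
noncomputable def quasiRemainder (m : ℕ) (q x : ℝ) : ℕ → ℝ
  | 0 => x
  | i + 1 => q * quasiRemainder m q x i - quasiDigit m q (quasiRemainder m q x i)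

lemma quasiDigit_lt {m : ℕ} {q x : ℝ} (h : 0 < q * x) : (quasiDigit m q x : ℝ) < q * x := by
  have h1 : 0 < ⌈q * x⌉₊ := Nat.ceil_pos.2 h
  have h2 : quasiDigit m q x < ⌈q * x⌉₊ := lt_of_le_of_lt (min_le_right _ _) (by omega)
  exact Nat.lt_ceil.1 h2

lemma eq_or_sub_quasiDigit_le_one (m : ℕ) (q x : ℝ) :
    quasiDigit m q x = m ∨ q * x - quasiDigit m q x ≤ 1 := by
  rcases le_total m (⌈q * x⌉₊ - 1) with h | h
  · exact Or.inl (min_eq_left h)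
  · right
    rw [quasiDigit, min_eq_right h]
    have h1 := Nat.le_ceil (q * x)
    have h2 : (⌈q * x⌉₊ : ℝ) ≤ (⌈q * x⌉₊ - 1 : ℕ) + 1 := by
      exact_mod_cast (by omega : ⌈q * x⌉₊ ≤ ⌈q * x⌉₊ - 1 + 1)
    linarith

lemma quasiRemainder_mem_Ioo {m : ℕ} {q x : ℝ} (hq : 1 < q) (hq' : q < m + 1)
    (hx : 0 < x ∧ x < (m : ℝ) / (q - 1)) (i : ℕ) :
    0 < quasiRemainder m q x i ∧ quasiRemainder m q x i < (m : ℝ) / (q - 1) := by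
  have hκ : (m : ℝ) / (q - 1) * (q - 1) = m := div_mul_cancel₀ _ (by linarith)
  induction i with
  | zero => exact hx
  | succ i ih =>
    rw [quasiRemainder]
    generalize quasiRemainder m q x i = y at ih
    refine ⟨sub_pos.2 (quasiDigit_lt (mul_pos (by linarith) ih.1)), ?_⟩
    rcases eq_or_sub_quasiDigit_le_one m q y with h | h
    · have := mul_lt_mul_of_pos_left ih.2 (by linarith : 0 < q)
      rw [h]; linarith
    · refine h.trans_lt ?_
      rw [lt_div_iff₀ (by linarith)]; linarith

lemma isRemainder_quasi {m : ℕ} {q x : ℝ} (hq : 1 < q) (hq' : q < m + 1)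
    (hx : 0 < x ∧ x < (m : ℝ) / (q - 1)) :
    IsRemainder q (fun i => quasiDigit m q (quasiRemainder m q x i)) (quasiRemainder m q x) :=
  ⟨fun _ => rfl, (m : ℝ) / (q - 1), fun i => by
    have := quasiRemainder_mem_Ioo hq hq' hx i
    rw [abs_of_pos this.1]; exact this.2.le⟩

/-- Membership of `1` in `V_q` bounds every reflected remainder after a nonzero digit. -/
lemma IsRemainder.ge_of_mem_Vq {m : ℕ} {q : ℝ} {α : ℕ → ℕ} {z : ℕ → ℝ} (hq : 1 < q)
    (hq' : q < m + 1) (hV : (1 : ℝ) ∈ Vq m q) (h : IsRemainder q α z) (hz0 : z 0 = 1)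
    (hα : ∀ i, α i ≤ m) (hz : ∀ i, 0 < z i ∧ z i < (m : ℝ) / (q - 1)) {j : ℕ} (hj : 0 < α j) :
    (m : ℝ) / (q - 1) - 1 ≤ z (j + 1) := by
  by_contra! hlt
  have hx : 0 < z (j + 1) + 1 ∧ z (j + 1) + 1 < (m : ℝ) / (q - 1) :=
    ⟨by linarith [(hz (j + 1)).1], by linarith⟩
  obtain ⟨X, c, hX, hX0, hXb, hc⟩ : ∃ (X : ℕ → ℝ) (c : ℕ → ℕ), IsRemainder q c X ∧
      X 0 = z (j + 1) + 1 ∧ (∀ i, 0 < X i ∧ X i < (m : ℝ) / (q - 1)) ∧ ∀ i, c i ≤ m :=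
    ⟨_, _, isRemainder_quasi hq hq' hx, rfl, quasiRemainder_mem_Ioo hq hq' hx,
      fun i => min_le_left _ _⟩
  set ρ : ℕ → ℝ := fun i => if i ≤ j then z i else X (i - (j + 1)) with hρ
  set d : ℕ → ℕ := fun i =>
    if i ≤ j then (if i = j then α i - 1 else α i) else c (i - (j + 1)) with hd
  have hρb : ∀ i, 0 < ρ i ∧ ρ i < (m : ℝ) / (q - 1) := fun i => by
    simp only [hρ]; split_ifs
    · exact hz i
    · exact hXb _
  have hρ0 : ρ 0 = 1 := by simp [hρ, hz0]
  have hdm : ∀ i, d i ≤ m := fun i => by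
    have := hα i
    simp only [hd]; split_ifs
    · omega
    · exact this
    · exact hc _
  have hρr : IsRemainder q d ρ := by
    refine ⟨fun i => ?_, (m : ℝ) / (q - 1), fun i => ?_⟩
    · rcases lt_trichotomy i j with hi | rfl | hi
      · simp only [hρ, hd, if_pos hi.le, if_pos (by omega : i + 1 ≤ j), if_neg hi.ne, h.1 i]
      · have e := h.1 i
        simp only [hρ, hd, le_refl, if_true, if_neg (by omega : ¬ i + 1 ≤ i), Nat.sub_self, hX0]
        push_cast [Nat.cast_sub hj]
        linarith
      · simp only [hρ, hd, if_neg (by omega : ¬ i ≤ j), if_neg (by omega : ¬ i + 1 ≤ j)]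
        rw [show i + 1 - (j + 1) = i - (j + 1) + 1 by omega, hX.1]
    · rw [abs_of_pos (hρb i).1]; exact (hρb i).2.le
  have heq := hV.2 d α (hρ0 ▸ hρr.expansion hq hdm) (hz0 ▸ h.expansion hq hα)
    (hρr.doublyInfinite_of_mem_Ioo hq hdm hρb) (h.doublyInfinite_of_mem_Ioo hq hα hz)
  have := congrFun heq j
  simp only [hd, le_refl, if_true] at this
  omega

/-- Bases `q < m + 1` in `V` have a quasi-greedy orbit of `1` confined to `[κ - 1, 1]`. -/
lemma exists_quasiOrbit {m : ℕ} {q : ℝ} (hq : 1 < q) (hq' : q < m + 1)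
    (hV : (1 : ℝ) ∈ Vq m q) :
    ∃ (z : ℕ → ℝ) (α : ℕ → ℕ), QuasiOrbit m q ((m : ℝ) / (q - 1)) z α := by
  have hκ : (m : ℝ) / (q - 1) * (q - 1) = m := div_mul_cancel₀ _ (by linarith)
  have h1κ : 1 < (m : ℝ) / (q - 1) := by rw [lt_div_iff₀ (by linarith)]; linarith
  have hx : (0 : ℝ) < 1 ∧ 1 < (m : ℝ) / (q - 1) := ⟨one_pos, h1κ⟩
  have hr := isRemainder_quasi hq hq' hx
  have hb := quasiRemainder_mem_Ioo hq hq' hx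
  have hge := fun j => hr.ge_of_mem_Vq hq hq' hV rfl (fun i => min_le_left _ _) hb (j := j)
  have hle : ∀ i, quasiRemainder m q 1 i ≤ 1 := fun i => by
    induction i with
    | zero => exact le_rfl
    | succ i ih =>
      rw [quasiRemainder]
      rcases eq_or_sub_quasiDigit_le_one m q (quasiRemainder m q 1 i) with h | h
      · rw [h]; nlinarith
      · exact h
  have hz0 : quasiRemainder m q 1 0 = 1 := rfl
  refine ⟨_, _, hq, hq', hκ, rfl, hr.1, fun i => (hb i).1, hle, fun i => ?_⟩
  induction i with
  | zero =>
    have hpos : 0 < quasiDigit m q (quasiRemainder m q 1 0) := by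
      by_contra! h0
      have h1 := hle 1
      rw [quasiRemainder, Nat.le_zero.1 h0, hz0] at h1
      push_cast at h1
      linarith
    linarith [hge 0 hpos, hle 1]
  | succ i ih =>
    rcases Nat.eq_zero_or_pos (quasiDigit m q (quasiRemainder m q 1 i)) with h0 | h0
    · rw [quasiRemainder, h0]
      push_cast
      nlinarith [(hb i).1]
    · exact hge i h0

lemma gratio_of_eq_two_mul {m k : ℕ} {q : ℝ} (hm : m = 2 * k) (hq : 2 * (q - 1) = m) :
    q = Gratio m := by
  subst hm
  push_cast at hq
  rw [Gratio, if_pos (by omega), show 2 * k / 2 = k by omega]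
  linarith

lemma gratio_of_eq_two_mul_add_one {m k : ℕ} {q : ℝ} (hq1 : 1 < q) (hm : m = 2 * k + 1)
    (hq : (q - k) * (q - 1) = m) : q = Gratio m := by
  subst hm
  push_cast at hq
  rw [Gratio, if_neg (by omega), show (2 * k + 1) / 2 = k by omega]
  have hk : (0 : ℝ) ≤ k := k.cast_nonneg
  have h1 : (k : ℝ) ^ 2 + 6 * k + 5 = (2 * q - (k + 1)) ^ 2 := by linear_combination (-4) * hq
  have h2 : (0 : ℝ) ≤ 2 * q - (k + 1) := by nlinarith
  rw [h1, Real.sqrt_sq h2]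
  ring

lemma add_one_mem_B2 {m : ℕ} (hm : 0 < m) : ((m : ℝ) + 1) ∈ B2 m := by
  have hm' : (0 : ℝ) < m := by exact_mod_cast hm
  have hq : (1 : ℝ) < m + 1 := by linarith
  have hκ : (m : ℝ) / ((m : ℝ) + 1 - 1) = 1 := by rw [add_sub_cancel_right]; field_simp
  have h0 : IsRemainder ((m : ℝ) + 1) (fun _ => 0) (fun _ => 0) :=
    ⟨fun _ => by simp, 0, fun _ => by simp⟩
  have h1 := isRemainder_const (m := m) hq
  rw [hκ] at h1
  refine mem_B2_of_unique hm ⟨hq, le_rfl⟩ (by rw [hκ]; norm_num) (x := 0) (a := fun _ => m)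
    (b := fun _ => 0) ?_ (h0.expansion hq fun _ => Nat.zero_le _) (fun d hd => ?_)
    (fun d hd => ?_)
  · rw [add_zero]; exact h1.expansion hq fun _ => le_rfl
  · rw [add_zero] at hd
    exact h1.eq_of_isExpansion hq (fun i hi => absurd hi (lt_irrefl _))
      (fun i _ => by rw [hκ]; norm_num) hd
  · exact h0.eq_of_isExpansion hq (fun _ _ => one_pos) (fun i hi => absurd hi (lt_irrefl _)) hd

lemma QuasiOrbit.mem_B2 {m : ℕ} {q κ : ℝ} {z : ℕ → ℝ} {α : ℕ → ℕ} (h : QuasiOrbit m q κ z α)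
    (hm : 0 < m) (hG : q ≠ Gratio m) : q ∈ B2 m := by
  have hq := h.one_lt
  have hκm := h.kappa_mul
  have e := h.step 0
  rw [h.zero, zero_add] at e
  have hκ : κ < 2 := by
    refine lt_of_le_of_ne (by linarith [h.ge 0, h.zero]) fun h2 => hG ?_
    subst h2
    have h1 : z 1 = 1 := le_antisymm (h.le_one 1) (by linarith [h.ge 1])
    have h3 : (m : ℝ) = (2 * α 0 : ℕ) := by push_cast; linarith
    exact gratio_of_eq_two_mul (by exact_mod_cast h3) hκm
  have hα : m + 1 ≤ 2 * α 0 := by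
    by_contra! hc
    have h1 : (2 * α 0 : ℝ) ≤ m := by exact_mod_cast (by omega : 2 * α 0 ≤ m)
    have := h.mul_two_sub
    nlinarith [h.le_one 1]
  by_cases hz : ∀ i, 0 < i → κ - 1 < z i ∧ z i < 1
  · exact h.mem_B2_of_lt hm hκ hz
  have hcut : ∃ n N, 0 < n ∧ z n = 1 ∧ QuasiOrbit.IsCut q κ z N ∧
      ∀ i, 0 < i → i < n → κ - 1 + z N / (q ^ N - 1) < q ^ (n - i) * (1 - z i) := by
    by_cases hu : ∀ i, 0 < i → κ - 1 < z i
    · refine h.exists_cut_of_forall_gt hα hu ?_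
      push Not at hz
      obtain ⟨i, hi, hi1⟩ := hz
      exact ⟨i, hi, le_antisymm (h.le_one i) (hi1 (hu i hi))⟩
    · push Not at hu
      obtain ⟨r, hr, hr1⟩ := hu
      refine h.exists_cut_of_eq hκ hα (fun hz1 => ?_) ⟨r, hr, le_antisymm hr1 (h.ge r)⟩
      by_contra! hc
      have hk : m = 2 * (α 0 - 1) + 1 := by omega
      refine hG (gratio_of_eq_two_mul_add_one hq hk ?_)
      have h1 : ((α 0 - 1 : ℕ) : ℝ) = α 0 - 1 := by rw [Nat.cast_sub (by omega)]; simp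
      rw [h1, ← hκm, show q - (α 0 - 1) = κ by linarith]
  obtain ⟨n, N, hn, hzn, hN, hlt⟩ := hcut
  exact h.mem_B2_of_cut hm hκ hn hzn hN hlt

/-- `V \ {G(m)} ⊆ B_2(m)`. -/
theorem stmt14 (m : ℕ) (hm : 0 < m) : Vset m \ {Gratio m} ⊆ B2 m := by
  rintro q ⟨⟨⟨hq, hq'⟩, hV⟩, hG⟩
  rcases hq'.eq_or_lt with rfl | hlt
  · exact add_one_mem_B2 hm
  · obtain ⟨z, α, h⟩ := exists_quasiOrbit hq hlt hV
    exact h.mem_B2 hm hG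
end
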